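/- arXiv:1710.00702 — 4 statements merged into one kernel-verified Lean document; each statement's English description precedes it below -/
import Mathlib

section
/- Let 1 ≤ p < ∞ and let Y = {y_k}_{k∈ℤ} ⊂ ℝ with L = sup_k |y_k − k| < ∞. If 2^p L < 1, then {τ_{y_k} rect}_{k∈ℤ} is a p-Riesz basis of V^p(rect; Y), where rect = χ_{[−1/2,1/2)}. -/
open MeasureTheory Filter Topology

noncomputable section

/-- `rect = χ_{[-1/2,1/2)}`. -/
def rect : ℝ → ℂ := Set.indicator (Set.Ico (-(1/2) : ℝ) (1/2)) 1

/-- `{τ_{x_k}ψ}_{k∈ℤ}` is a `p`-Riesz basis (of `V^p(ψ;X)`) with constants `A, B`. -/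
def IsPRieszBasis1 (p : ℝ) (ψ : ℝ → ℂ) (x : ℤ → ℝ) (A B : ℝ) : Prop :=
  ∀ (s : Finset ℤ) (c : ℤ → ℂ),
    ENNReal.ofReal (A * (∑ k ∈ s, ‖c k‖ ^ p) ^ (1/p)) ≤
      eLpNorm (fun t => ∑ k ∈ s, c k • ψ (t + x k)) (ENNReal.ofReal p) volume ∧
    eLpNorm (fun t => ∑ k ∈ s, c k • ψ (t + x k)) (ENNReal.ofReal p) volume ≤
      ENNReal.ofReal (B * (∑ k ∈ s, ‖c k‖ ^ p) ^ (1/p))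

lemma rect_of_mem {t : ℝ} (h1 : -(1/2) ≤ t) (h2 : t < 1/2) : rect t = 1 := by
  unfold rect
  rw [Set.indicator_of_mem (Set.mem_Ico.2 ⟨h1, h2⟩)]; rfl

lemma rect_of_not_mem {t : ℝ} (h : ¬ (-(1/2) ≤ t ∧ t < 1/2)) : rect t = 0 := by
  unfold rect
  rw [Set.indicator_of_notMem (fun h' => h (Set.mem_Ico.1 h'))]

lemma rect_upper_pt (p : ℝ) (hp : 1 ≤ p) (y : ℤ → ℝ) (L : ℝ) (hL2 : L < 1/2)
    (hL : ∀ k : ℤ, |y k - k| ≤ L) (s : Finset ℤ) (c : ℤ → ℂ) (t : ℝ) :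
    ‖∑ k ∈ s, c k • rect (t + y k)‖ₑ ^ p ≤
      2 ^ p * ∑ k ∈ s, (Set.Ico (-(1/2) - y k) (1/2 - y k)).indicator
        (fun _ => ‖c k‖ₑ ^ p) t := by
  classical
  have hp0 : 0 < p := by linarith
  set T := s.filter (fun k => -(1/2) ≤ t + y k ∧ t + y k < 1/2) with hT
  have h1 : ∑ k ∈ s, c k • rect (t + y k) = ∑ k ∈ T, c k := by
    rw [hT, Finset.sum_filter]
    refine Finset.sum_congr rfl fun k _ => ?_
    split_ifs with h
    · rw [rect_of_mem h.1 h.2]; simp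
    · rw [rect_of_not_mem h]; simp
  have h2 : ∑ k ∈ s, (Set.Ico (-(1/2) - y k) (1/2 - y k)).indicator
        (fun _ => ‖c k‖ₑ ^ p) t = ∑ k ∈ T, ‖c k‖ₑ ^ p := by
    rw [hT, Finset.sum_filter]
    refine Finset.sum_congr rfl fun k _ => ?_
    rw [Set.indicator_apply]
    refine if_congr ?_ rfl rfl
    rw [Set.mem_Ico]
    constructor <;> rintro ⟨h, h'⟩ <;> constructor <;> linarith
  have hcard : T.card ≤ 2 := by
    have hsub : T ⊆ {⌊-t⌋, ⌊-t⌋ + 1} := by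
      intro k hk
      rw [hT, Finset.mem_filter] at hk
      obtain ⟨_, ha, hb⟩ := hk
      have hk := abs_le.1 (hL k)
      have e1 := Int.floor_le (-t)
      have e2 := Int.lt_floor_add_one (-t)
      have f1 : ⌊-t⌋ - 1 < k := by
        have : ((⌊-t⌋ - 1 : ℤ) : ℝ) < k := by push_cast; linarith [hk.1, hk.2]
        exact_mod_cast this
      have f2 : k < ⌊-t⌋ + 2 := by
        have : (k : ℝ) < ((⌊-t⌋ + 2 : ℤ) : ℝ) := by push_cast; linarith [hk.1, hk.2]
        exact_mod_cast this
      simp only [Finset.mem_insert, Finset.mem_singleton]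
      omega
    exact (Finset.card_le_card hsub).trans Finset.card_le_two
  rw [h1, h2]
  set S := ∑ k ∈ T, ‖c k‖ₑ ^ p with hS
  have h3 : ‖∑ k ∈ T, c k‖ₑ ≤ 2 * S ^ (1/p) := by
    calc ‖∑ k ∈ T, c k‖ₑ ≤ ∑ k ∈ T, ‖c k‖ₑ := enorm_sum_le _ _
      _ ≤ ∑ k ∈ T, S ^ (1/p) := by
        refine Finset.sum_le_sum fun k hk => ?_
        rw [one_div, ENNReal.le_rpow_inv_iff hp0]
        exact Finset.single_le_sum (f := fun k => ‖c k‖ₑ ^ p) (fun _ _ => zero_le) hk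
      _ = T.card * S ^ (1/p) := by simp
      _ ≤ 2 * S ^ (1/p) := by
        gcongr
        exact_mod_cast hcard
  calc ‖∑ k ∈ T, c k‖ₑ ^ p ≤ (2 * S ^ (1/p)) ^ p := by gcongr
    _ = 2 ^ p * S := by
      rw [ENNReal.mul_rpow_of_nonneg _ _ hp0.le, ← ENNReal.rpow_mul,
        one_div_mul_cancel hp0.ne', ENNReal.rpow_one]

lemma rect_lower_pt (p : ℝ) (hp : 1 ≤ p) (y : ℤ → ℝ) (L : ℝ) (hL0 : 0 ≤ L)
    (hL : ∀ k : ℤ, |y k - k| ≤ L) (s : Finset ℤ) (c : ℤ → ℂ) (t : ℝ) :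
    ∑ k ∈ s, (Set.Ico (-(k:ℝ) - 1/2 + L) (-(k:ℝ) + 1/2 - L)).indicator
        (fun _ => ‖c k‖ₑ ^ p) t ≤ ‖∑ k ∈ s, c k • rect (t + y k)‖ₑ ^ p := by
  classical
  by_cases h : ∃ k ∈ s, t ∈ Set.Ico (-(k:ℝ) - 1/2 + L) (-(k:ℝ) + 1/2 - L)
  · obtain ⟨k, hks, hk⟩ := h
    have hk' := Set.mem_Ico.1 hk
    have key : ∀ j : ℤ, j ≠ k → (j : ℝ) + 1 ≤ k ∨ (k : ℝ) + 1 ≤ j := by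
      intro j hj
      rcases lt_or_gt_of_ne hj with h | h
      · left; exact_mod_cast h
      · right; exact_mod_cast h
    rw [Finset.sum_eq_single k, Finset.sum_eq_single k]
    · rw [Set.indicator_of_mem hk]
      have := abs_le.1 (hL k)
      rw [rect_of_mem (by linarith [this.1]) (by linarith [this.2])]
      simp
    · intro j _ hj
      have := abs_le.1 (hL j)
      rw [rect_of_not_mem, smul_zero]
      rintro ⟨h1, h2⟩
      rcases key j hj with h | h <;> linarith [this.1, this.2]
    · intro h; exact absurd hks h
    · intro j _ hj
      apply Set.indicator_of_notMem
      rw [Set.mem_Ico]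
      rintro ⟨h1, h2⟩
      rcases key j hj with h | h <;> linarith
    · intro h; exact absurd hks h
  · push Not at h
    rw [Finset.sum_eq_zero]
    · exact zero_le
    · intro k hk
      exact Set.indicator_of_notMem (h k hk) _

/-- Theorem 4.7 of the paper. If `L = sup_k |y_k − k| < ∞` and
`2^p L < 1`, then `{τ_{y_k} rect}_{k∈ℤ}` is a `p`-Riesz basis of `V^p(rect; Y)`. -/
theorem stmt13 (p : ℝ) (hp : 1 ≤ p)
    (y : ℤ → ℝ) (L : ℝ) (hL0 : 0 ≤ L) (hL : ∀ k : ℤ, |y k - k| ≤ L)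
    (hcond : 2 ^ p * L < 1) :
    ∃ A B : ℝ, 0 < A ∧ 0 < B ∧ IsPRieszBasis1 p rect y A B := by
  have hp0 : 0 < p := by linarith
  have h2p : (2:ℝ) ≤ 2 ^ p := by
    simpa using Real.rpow_le_rpow_of_exponent_le (x := 2) (by norm_num) hp
  have hL2 : L < 1/2 := by nlinarith
  have hpos : 0 < 1 - 2 * L := by linarith
  refine ⟨(1 - 2 * L) ^ (1/p), 2, by positivity, by norm_num, ?_⟩
  intro s c
  have hS0 : 0 ≤ ∑ k ∈ s, ‖c k‖ ^ p := Finset.sum_nonneg fun k _ => by positivity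
  have hS : ENNReal.ofReal (∑ k ∈ s, ‖c k‖ ^ p) = ∑ k ∈ s, ‖c k‖ₑ ^ p := by
    rw [ENNReal.ofReal_sum_of_nonneg (fun k _ => by positivity)]
    refine Finset.sum_congr rfl fun k _ => ?_
    rw [← ENNReal.ofReal_rpow_of_nonneg (norm_nonneg _) hp0.le, ofReal_norm]
  have hne0 : ENNReal.ofReal p ≠ 0 := by simpa using hp0
  rw [eLpNorm_eq_lintegral_rpow_enorm_toReal hne0 ENNReal.ofReal_ne_top,
    ENNReal.toReal_ofReal hp0.le]
  have h1p : 0 ≤ 1/p := by positivity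
  constructor
  · rw [← Real.mul_rpow hpos.le hS0, ← ENNReal.ofReal_rpow_of_nonneg (by positivity) h1p]
    refine ENNReal.rpow_le_rpow ?_ h1p
    refine le_trans (le_of_eq ?_) (lintegral_mono (rect_lower_pt p hp y L hL0 hL s c))
    rw [lintegral_finsetSum _ (fun k _ => measurable_const.indicator measurableSet_Ico),
      ENNReal.ofReal_mul hpos.le, hS, Finset.mul_sum]
    refine Finset.sum_congr rfl fun k _ => ?_
    rw [lintegral_indicator_const measurableSet_Ico, Real.volume_Ico, mul_comm]
    congr 2
    ring
  · rw [ENNReal.ofReal_mul (by norm_num), ← ENNReal.ofReal_rpow_of_nonneg hS0 h1p, hS]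
    have : ENNReal.ofReal 2 * (∑ k ∈ s, ‖c k‖ₑ ^ p) ^ (1/p)
        = (2 ^ p * ∑ k ∈ s, ‖c k‖ₑ ^ p) ^ (1/p) := by
      rw [ENNReal.mul_rpow_of_nonneg _ _ h1p, ← ENNReal.rpow_mul,
        mul_one_div_cancel hp0.ne', ENNReal.rpow_one]
      simp
    rw [this]
    refine ENNReal.rpow_le_rpow ?_ h1p
    refine le_trans (lintegral_mono (rect_upper_pt p hp y L hL2 hL s c)) (le_of_eq ?_)
    rw [lintegral_const_mul _ (Finset.measurable_fun_sum _
        (fun k _ => measurable_const.indicator measurableSet_Ico)),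
      lintegral_finsetSum _ (fun k _ => measurable_const.indicator measurableSet_Ico)]
    congr 1
    refine Finset.sum_congr rfl fun k _ => ?_
    rw [lintegral_indicator_const measurableSet_Ico, Real.volume_Ico]
    norm_num
end
end

section
/- Let ψ₀ ∈ L^1(ℝ) be such that ψ̂₀(x) ≠ 0 for every x ∈ ℝ, and let ψ = rect * ψ₀ with rect = χ_{[−1/2,1/2)}. Then for every y ∈ [−1/2, 1/2), Σ_{m∈ℤ} |ψ̂(y+m)|² ≠ 0; indeed ψ̂(x) = ψ̂₀(x)·sinc(x) where sinc(x) = sin(πx)/(πx) (with sinc(0) = 1), and Σ_{m∈ℤ} |sinc(y+m)|² ≠ 0 for every y ∈ [−1/2, 1/2). -/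
open MeasureTheory Filter Topology

noncomputable section

/-- Convolution `(f*g)(t) = ∫ f(t−y) g(y) dy`. -/
def conv (f g : ℝ → ℂ) : ℝ → ℂ := fun t => ∫ u : ℝ, f (t - u) * g u

/-- Fourier transform `f̂(y) = ∫ e^{2πi xy} f(x) dx`. -/
def FT1 (f : ℝ → ℂ) (y : ℝ) : ℂ :=
  ∫ x : ℝ, Complex.exp (2 * Real.pi * Complex.I * (x * y)) * f x

/-- `sinc(x) = sin(πx)/(πx)`, with `sinc(0) = 1`. -/
def sinc (x : ℝ) : ℝ := if x = 0 then 1 else Real.sin (Real.pi * x) / (Real.pi * x)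

open scoped FourierTransform Convolution in
lemma FT1_eq_fourier (f : ℝ → ℂ) (x : ℝ) : FT1 f x = 𝓕 f (-x) := by
  rw [Real.fourier_real_eq_integral_exp_smul]
  unfold FT1
  congr 1
  ext v
  rw [smul_eq_mul]
  congr 2
  push_cast
  ring

lemma rect_integrable : Integrable rect volume := by
  unfold rect
  rw [integrable_indicator_iff measurableSet_Ico]
  show IntegrableOn (fun _ => (1 : ℂ)) _ _
  simp

open scoped FourierTransform Convolution in
lemma FT1_conv (f : ℝ → ℂ) (hf : Integrable f volume) (x : ℝ) :
    FT1 (conv rect f) x = FT1 f x * FT1 rect x := by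
  have h : conv rect f = (f ⋆[ContinuousLinearMap.mul ℂ ℂ] rect) := by
    ext t
    simp only [conv, convolution, ContinuousLinearMap.mul_apply']
    congr 1
    ext u
    ring
  rw [h, FT1_eq_fourier, FT1_eq_fourier, FT1_eq_fourier,
    Real.fourier_mul_convolution_eq hf rect_integrable]

lemma FT1_rect (x : ℝ) : FT1 rect x = (sinc x : ℂ) := by
  have h1 : FT1 rect x = ∫ t in (-(1/2) : ℝ)..(1/2),
      Complex.exp ((2 * Real.pi * Complex.I * x) * t) := by
    rw [intervalIntegral.integral_of_le (by norm_num), ← integral_Ico_eq_integral_Ioc,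
      ← integral_indicator measurableSet_Ico]
    unfold FT1 rect
    congr 1
    ext t
    by_cases ht : t ∈ Set.Ico (-(1/2) : ℝ) (1/2)
    · rw [Set.indicator_of_mem ht, Set.indicator_of_mem ht]
      simp only [Pi.one_apply, mul_one]
      congr 1
      ring
    · rw [Set.indicator_of_notMem ht, Set.indicator_of_notMem ht, mul_zero]
  rw [h1]
  by_cases hx : x = 0
  · subst hx
    simp [sinc]
    norm_num
  · have hxc : (x : ℂ) ≠ 0 := by exact_mod_cast hx
    have hpi : (Real.pi : ℂ) ≠ 0 := by exact_mod_cast Real.pi_ne_zero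
    have hc : (2 * Real.pi * Complex.I * x : ℂ) ≠ 0 := by
      simp [hxc, hpi]
    rw [integral_exp_mul_complex hc]
    simp only [sinc, if_neg hx]
    push_cast
    rw [Complex.sin]
    have e1 : (2 * Real.pi * Complex.I * x * (1 / 2) : ℂ) = Real.pi * x * Complex.I := by ring
    have e2 : (2 * Real.pi * Complex.I * x * (-(1 / 2)) : ℂ) = -(Real.pi * x) * Complex.I := by ring
    rw [e1, e2]
    field_simp
    rw [Complex.I_sq]
    ring

lemma FT1_norm_le (f : ℝ → ℂ) (x : ℝ) : ‖FT1 f x‖ ≤ ∫ t, ‖f t‖ := by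
  unfold FT1
  refine (norm_integral_le_integral_norm _).trans (le_of_eq ?_)
  congr 1
  ext t
  rw [norm_mul]
  have : (2 * Real.pi * Complex.I * (t * x) : ℂ) = ((2 * Real.pi * (t * x) : ℝ) : ℂ) * Complex.I := by
    push_cast; ring
  rw [this, Complex.norm_exp_ofReal_mul_I, one_mul]

lemma sinc_sq_le (x : ℝ) (hx : x ≠ 0) : sinc x ^ 2 ≤ 1 / |x| ^ (2 : ℝ) := by
  have hp : (1 : ℝ) ≤ Real.pi ^ 2 := by nlinarith [Real.pi_gt_three]
  have hx2 : 0 < x ^ 2 := by positivity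
  rw [Real.rpow_two, sq_abs, sinc, if_neg hx, div_pow, mul_pow]
  apply div_le_div₀ zero_le_one (Real.sin_sq_le_one _) hx2
  nlinarith

lemma sinc_summable (y : ℝ) (hy : y ∈ Set.Ico (-(1/2) : ℝ) (1/2)) :
    Summable fun m : ℤ => sinc (y + m) ^ 2 := by
  have h := (Real.summable_one_div_int_add_rpow y 2).2 (by norm_num)
  refine Summable.of_norm_bounded_eventually h ?_
  have : {m : ℤ | ¬ (‖sinc (y + m) ^ 2‖ ≤ 1 / |(m : ℝ) + y| ^ (2 : ℝ))} ⊆ {0} := by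
    intro m hm
    by_contra hne
    apply hm
    rw [Real.norm_of_nonneg (sq_nonneg _), add_comm]
    apply sinc_sq_le
    intro h0
    have h1 : (m : ℝ) < 1 := by linarith [hy.1]
    have h2 : (-1 : ℝ) < m := by linarith [hy.2]
    have h1' : m < 1 := by exact_mod_cast h1
    have h2' : -1 < m := by exact_mod_cast h2
    apply hne
    show m = 0
    omega
  exact (Set.finite_singleton (0 : ℤ)).subset this

lemma sinc_ne_zero (y : ℝ) (hy : y ∈ Set.Ico (-(1/2) : ℝ) (1/2)) : sinc y ≠ 0 := by
  unfold sinc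
  split_ifs with h
  · exact one_ne_zero
  · refine div_ne_zero ?_ (mul_ne_zero Real.pi_ne_zero h)
    have hp := Real.pi_pos
    intro hs
    have := (Real.sin_eq_zero_iff_of_lt_of_lt (by nlinarith [hy.1]) (by nlinarith [hy.2])).1 hs
    exact mul_ne_zero Real.pi_ne_zero h this

/-- remark after Corollary 4.8 of the paper. If `ψ₀ ∈ L¹(ℝ)` with
`ψ̂₀(x) ≠ 0` for every `x`, and `ψ = rect * ψ₀`, then `Σ_{m∈ℤ} |ψ̂(y+m)|² ≠ 0` for every
`y ∈ [−1/2,1/2)`; indeed `ψ̂ = ψ̂₀ · sinc` and `Σ_{m∈ℤ} |sinc(y+m)|² ≠ 0` on `[−1/2,1/2)`. -/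
theorem stmt15 (ψ₀ : ℝ → ℂ) (hψ₀ : Integrable ψ₀ volume)
    (hhat : ∀ x : ℝ, FT1 ψ₀ x ≠ 0)
    (ψ : ℝ → ℂ) (hψ : ψ = conv rect ψ₀) :
    (∀ y ∈ Set.Ico (-(1/2) : ℝ) (1/2), (∑' m : ℤ, ‖FT1 ψ (y + m)‖ ^ 2) ≠ 0) ∧
    (∀ x : ℝ, FT1 ψ x = FT1 ψ₀ x * (sinc x : ℂ)) ∧
    (∀ y ∈ Set.Ico (-(1/2) : ℝ) (1/2), (∑' m : ℤ, (sinc (y + m)) ^ 2) ≠ 0) := by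
  have key : ∀ x : ℝ, FT1 ψ x = FT1 ψ₀ x * (sinc x : ℂ) := by
    intro x
    rw [hψ, FT1_conv ψ₀ hψ₀, FT1_rect]
  refine ⟨?_, key, ?_⟩
  · intro y hy
    have hs : Summable fun m : ℤ => ‖FT1 ψ (y + m)‖ ^ 2 := by
      have h := (sinc_summable y hy).mul_left ((∫ t, ‖ψ₀ t‖) ^ 2)
      refine Summable.of_nonneg_of_le (fun _ => sq_nonneg _) (fun m => ?_) h
      have e : ‖FT1 ψ (y + m)‖ ^ 2 = ‖FT1 ψ₀ (y + m)‖ ^ 2 * sinc (y + m) ^ 2 := by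
        rw [key, norm_mul, mul_pow, Complex.norm_real, Real.norm_eq_abs, sq_abs]
      rw [e]
      exact mul_le_mul_of_nonneg_right
        (pow_le_pow_left₀ (norm_nonneg _) (FT1_norm_le ψ₀ _) 2) (sq_nonneg _)
    refine ne_of_gt (hs.tsum_pos (fun _ => sq_nonneg _) 0 ?_)
    have hne : FT1 ψ (y + ((0 : ℤ) : ℝ)) ≠ 0 := by
      rw [Int.cast_zero, add_zero, key]
      exact mul_ne_zero (hhat y) (by exact_mod_cast sinc_ne_zero y hy)
    exact pow_pos (norm_pos_iff.2 hne) 2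
  · intro y hy
    refine ne_of_gt ((sinc_summable y hy).tsum_pos (fun _ => sq_nonneg _) 0 ?_)
    rw [Int.cast_zero, add_zero]
    exact sq_pos_of_ne_zero (sinc_ne_zero y hy)
end
end

section
/- Let 1 ≤ p < ∞, let m ≥ 1, and let β_m = rect^{(m+1)} be the B-spline of order m (the (m+1)-fold iterated convolution of rect = χ_{[−1/2,1/2)}). Suppose {τ_k β_m}_{k∈ℤ} is a p-Riesz basis of V^p(β_m) with lower constant A_p(m) > 0. Let Y = {y_k}_{k∈ℤ} ⊂ ℝ with L = sup_k |y_k − k|. If L < 2^{−p} A_p(m) (and L < 1), then {τ_{y_k} β_m}_{k∈ℤ} is a p-Riesz basis of V^p(β_m; Y). -/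
open MeasureTheory Filter Topology

noncomputable section

/-- The B-spline of order `m`: `β_m = rect^{(m+1)}`, the `(m+1)`-fold iterated
convolution of `rect`. -/
def bspline : ℕ → (ℝ → ℂ)
  | 0 => rect
  | n + 1 => conv (bspline n) rect

/-- The properties of `β_n` used below. -/
def GoodSpline (f : ℝ → ℂ) : Prop :=
  Measurable f ∧ (∫⁻ t, ‖f t‖ₑ ≤ 1) ∧
    ∀ (s : Finset ℤ) (v : ℝ), ∑ k ∈ s, ‖f (v + k)‖ₑ ≤ 1

lemma rect_measurable : Measurable rect :=
  measurable_one.indicator measurableSet_Ico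

lemma rect_enorm (t : ℝ) :
    ‖rect t‖ₑ = Set.indicator (Set.Ico (-(1/2) : ℝ) (1/2)) (1 : ℝ → ENNReal) t := by
  unfold rect
  by_cases h : t ∈ Set.Ico (-(1/2) : ℝ) (1/2)
  · rw [Set.indicator_of_mem h, Set.indicator_of_mem h]; simp
  · rw [Set.indicator_of_notMem h, Set.indicator_of_notMem h]; simp

lemma rect_lintegral : ∫⁻ t, ‖rect t‖ₑ = 1 := by
  simp_rw [rect_enorm]
  rw [lintegral_indicator_one measurableSet_Ico, Real.volume_Ico]
  norm_num

lemma good_rect : GoodSpline rect := by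
  refine ⟨rect_measurable, rect_lintegral.le, ?_⟩
  intro s v
  by_cases h : ∃ k ∈ s, v + (k : ℝ) ∈ Set.Ico (-(1/2) : ℝ) (1/2)
  · obtain ⟨k, hk, hkv⟩ := h
    rw [Finset.sum_eq_single_of_mem k hk]
    · rw [rect_enorm, Set.indicator_of_mem hkv]; simp
    · intro j hj hjk
      rw [rect_enorm, Set.indicator_of_notMem]
      intro hjv
      apply hjk
      have h1 : ((j - k : ℤ) : ℝ) < 1 := by push_cast; linarith [hjv.2, hkv.1]
      have h2 : ((k - j : ℤ) : ℝ) < 1 := by push_cast; linarith [hkv.2, hjv.1]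
      have h1' : j - k < 1 := by exact_mod_cast h1
      have h2' : k - j < 1 := by exact_mod_cast h2
      omega
  · push Not at h
    rw [Finset.sum_eq_zero]
    · simp
    · intro k hk
      rw [rect_enorm, Set.indicator_of_notMem (h k hk)]

lemma enorm_conv_le (f g : ℝ → ℂ) (t : ℝ) :
    ‖conv f g t‖ₑ ≤ ∫⁻ u, ‖f (t - u)‖ₑ * ‖g u‖ₑ := by
  unfold conv
  refine (enorm_integral_le_lintegral_enorm _).trans (le_of_eq ?_)
  simp only [enorm_mul]

lemma good_conv {f : ℝ → ℂ} (hf : GoodSpline f) : GoodSpline (conv f rect) := by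
  obtain ⟨hfm, hf1, hfs⟩ := hf
  have hrm := rect_measurable
  refine ⟨?_, ?_, ?_⟩
  · have : StronglyMeasurable (Function.uncurry (fun t u : ℝ => f (t - u) * rect u)) := by
      apply Measurable.stronglyMeasurable
      unfold Function.uncurry
      fun_prop
    exact (this.integral_prod_right (ν := volume)).measurable
  · calc ∫⁻ t, ‖conv f rect t‖ₑ ≤ ∫⁻ t, ∫⁻ u, ‖f (t - u)‖ₑ * ‖rect u‖ₑ :=
          lintegral_mono (enorm_conv_le f rect)
      _ = ∫⁻ u, ∫⁻ t, ‖f (t - u)‖ₑ * ‖rect u‖ₑ := by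
          apply lintegral_lintegral_swap
          unfold Function.uncurry
          fun_prop
      _ = ∫⁻ u, (∫⁻ t, ‖f t‖ₑ) * ‖rect u‖ₑ := by
          congr 1; ext u
          rw [lintegral_mul_const _ (by fun_prop),
            lintegral_sub_right_eq_self (fun t => ‖f t‖ₑ) u]
      _ ≤ ∫⁻ u, 1 * ‖rect u‖ₑ := lintegral_mono fun u => by dsimp only; gcongr
      _ = 1 := by simp [rect_lintegral]
  · intro s v
    calc ∑ k ∈ s, ‖conv f rect (v + k)‖ₑ
        ≤ ∑ k ∈ s, ∫⁻ u, ‖f (v + k - u)‖ₑ * ‖rect u‖ₑ :=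
          Finset.sum_le_sum fun k _ => enorm_conv_le f rect _
      _ = ∫⁻ u, ∑ k ∈ s, ‖f (v + k - u)‖ₑ * ‖rect u‖ₑ := by
          rw [lintegral_finsetSum]
          intro k _
          fun_prop
      _ ≤ ∫⁻ u, 1 * ‖rect u‖ₑ := by
          apply lintegral_mono
          intro u
          dsimp only
          rw [← Finset.sum_mul]
          gcongr
          have := hfs s (v - u)
          simpa only [sub_add_eq_add_sub] using this
      _ = 1 := by simp [rect_lintegral]

lemma good_bspline (n : ℕ) : GoodSpline (bspline n) := by
  induction n with
  | zero => exact good_rect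
  | succ n ih => exact good_conv ih

/-- Difference of two translates of `rect`, bounded by an indicator. -/
lemma rect_diff_le (δ w : ℝ) :
    ‖rect (w + δ) - rect w‖ₑ ≤ Set.indicator
      (Set.uIcc (-(1/2)) (-(1/2) - δ) ∪ Set.uIcc (1/2) (1/2 - δ)) (1 : ℝ → ENNReal) w := by
  by_cases h : w ∈ (Set.uIcc (-(1/2)) (-(1/2) - δ) ∪ Set.uIcc (1/2) (1/2 - δ) : Set ℝ)
  · rw [Set.indicator_of_mem h]
    unfold rect Set.indicator
    split_ifs <;> simp
  · rw [Set.indicator_of_notMem h]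
    simp only [Set.mem_union, Set.mem_uIcc, not_or, not_and, not_le] at h
    obtain ⟨⟨h1, h2⟩, h3, h4⟩ := h
    have : w + δ ∈ Set.Ico (-(1/2) : ℝ) (1/2) ↔ w ∈ Set.Ico (-(1/2) : ℝ) (1/2) := by
      simp only [Set.mem_Ico]
      constructor
      · rintro ⟨a, b⟩
        constructor
        · by_contra hc
          push Not at hc
          linarith [h2 (by linarith)]
        · by_contra hc
          push Not at hc
          linarith [h3 hc]
      · rintro ⟨a, b⟩
        constructor
        · by_contra hc
          push Not at hc
          linarith [h1 a]
        · by_contra hc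
          push Not at hc
          linarith [h4 (by linarith)]
    unfold rect Set.indicator
    simp only [this, Pi.one_apply, sub_self, enorm_zero, le_refl]

/-- The majorant of `|β(x+k+δ) - β(x+k)|`. -/
def majK (f : ℝ → ℂ) (δ : ℝ) (t : ℝ) : ENNReal :=
  ∫⁻ w, ‖f (t - w)‖ₑ * ‖rect (w + δ) - rect w‖ₑ

lemma diff_le_majK {f : ℝ → ℂ} (hf : GoodSpline f) (δ t : ℝ) :
    ‖conv f rect (t + δ) - conv f rect t‖ₑ ≤ majK f δ t := by
  obtain ⟨hfm, hf1, -⟩ := hf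
  have hint : Integrable f := ⟨hfm.aestronglyMeasurable, lt_of_le_of_lt hf1 ENNReal.one_lt_top⟩
  have hrm := rect_measurable
  have hb : ∀ w, ‖rect w‖ ≤ 1 := by
    intro w; unfold rect Set.indicator; split_ifs <;> simp
  have e1 : conv f rect (t + δ) = ∫ w, f (t - w) * rect (w + δ) := by
    unfold conv
    rw [← integral_add_right_eq_self (fun u => f (t + δ - u) * rect u) δ]
    congr 1; ext w; congr 2; ring
  have i0 : Integrable (fun w => f (t - w)) := hint.comp_sub_left t
  have i1 : Integrable (fun w => f (t - w) * rect (w + δ)) :=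
    i0.mul_bdd (c := 1) (hrm.comp (measurable_add_const δ)).aestronglyMeasurable (ae_of_all _ fun w => hb _)
  have i2 : Integrable (fun w => f (t - w) * rect w) :=
    i0.mul_bdd (c := 1) hrm.aestronglyMeasurable (ae_of_all _ fun w => hb _)
  rw [e1]
  unfold conv majK
  rw [← integral_sub i1 i2]
  refine (enorm_integral_le_lintegral_enorm _).trans (le_of_eq ?_)
  simp only [← mul_sub, enorm_mul]

lemma majK_measurable {f : ℝ → ℂ} (hf : GoodSpline f) (δ : ℝ) : Measurable (majK f δ) := by
  have hfm := hf.1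
  have hrm := rect_measurable
  unfold majK
  apply Measurable.lintegral_prod_right
  fun_prop

lemma vol_uIcc (a δ L : ℝ) (h : |δ| ≤ L) :
    volume (Set.uIcc a (a - δ)) ≤ ENNReal.ofReal L := by
  rw [Set.uIcc, Real.volume_Icc, max_sub_min_eq_abs]
  apply ENNReal.ofReal_le_ofReal
  simpa using h

lemma majK_lintegral {f : ℝ → ℂ} (hf : GoodSpline f) {δ L : ℝ} (h : |δ| ≤ L) :
    ∫⁻ t, majK f δ t ≤ 2 * ENNReal.ofReal L := by
  obtain ⟨hfm, hf1, -⟩ := hf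
  have hrm := rect_measurable
  unfold majK
  calc ∫⁻ t, ∫⁻ w, ‖f (t - w)‖ₑ * ‖rect (w + δ) - rect w‖ₑ
      = ∫⁻ w, ∫⁻ t, ‖f (t - w)‖ₑ * ‖rect (w + δ) - rect w‖ₑ := by
        apply lintegral_lintegral_swap
        unfold Function.uncurry
        fun_prop
    _ = ∫⁻ w, (∫⁻ t, ‖f t‖ₑ) * ‖rect (w + δ) - rect w‖ₑ := by
        congr 1; ext u
        rw [lintegral_mul_const _ (by fun_prop),
          lintegral_sub_right_eq_self (fun t => ‖f t‖ₑ) u]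
    _ ≤ ∫⁻ w, 1 * Set.indicator
      (Set.uIcc (-(1/2)) (-(1/2) - δ) ∪ Set.uIcc (1/2) (1/2 - δ)) (1 : ℝ → ENNReal) w := by
        apply lintegral_mono
        intro w
        exact mul_le_mul' hf1 (rect_diff_le δ w)
    _ = volume (Set.uIcc (-(1/2)) (-(1/2) - δ) ∪ Set.uIcc (1/2) (1/2 - δ) : Set ℝ) := by
        simp only [one_mul]
        rw [lintegral_indicator_one (measurableSet_uIcc.union measurableSet_uIcc)]
    _ ≤ _ := by
        refine (measure_union_le _ _).trans ?_
        rw [two_mul]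
        exact add_le_add (vol_uIcc _ _ _ h) (vol_uIcc _ _ _ h)

lemma majK_sum {f : ℝ → ℂ} (hf : GoodSpline f) {δ : ℤ → ℝ} {L : ℝ} (h : ∀ k, |δ k| ≤ L)
    (s : Finset ℤ) (x : ℝ) :
    ∑ k ∈ s, majK f (δ k) (x + k) ≤ 4 * ENNReal.ofReal L := by
  obtain ⟨hfm, hf1, hfs⟩ := hf
  have hrm := rect_measurable
  set S : Set ℝ := Set.Icc (-(1/2) - L) (-(1/2) + L) ∪ Set.Icc (1/2 - L) (1/2 + L) with hS
  have hSm : MeasurableSet S := measurableSet_Icc.union measurableSet_Icc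
  have hle : ∀ k w, ‖rect (w + δ k) - rect w‖ₑ ≤ S.indicator (1 : ℝ → ENNReal) w := by
    intro k w
    refine (rect_diff_le (δ k) w).trans ?_
    apply Set.indicator_le_indicator_of_subset _ (fun _ => bot_le)
    have hk := abs_le.1 (h k)
    apply Set.union_subset_union <;>
    · apply Set.uIcc_subset_Icc <;> constructor <;> linarith [hk.1, hk.2]
  unfold majK
  calc ∑ k ∈ s, ∫⁻ w, ‖f (x + k - w)‖ₑ * ‖rect (w + δ k) - rect w‖ₑ
      = ∫⁻ w, ∑ k ∈ s, ‖f (x + k - w)‖ₑ * ‖rect (w + δ k) - rect w‖ₑ := by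
        rw [lintegral_finsetSum]
        intro k _
        fun_prop
    _ ≤ ∫⁻ w, S.indicator (1 : ℝ → ENNReal) w := by
        apply lintegral_mono
        intro w
        calc ∑ k ∈ s, ‖f (x + k - w)‖ₑ * ‖rect (w + δ k) - rect w‖ₑ
            ≤ ∑ k ∈ s, ‖f (x + k - w)‖ₑ * S.indicator (1 : ℝ → ENNReal) w :=
              Finset.sum_le_sum fun k _ => by gcongr; exact hle k w
          _ ≤ 1 * S.indicator (1 : ℝ → ENNReal) w := by
              rw [← Finset.sum_mul]
              gcongr
              have := hfs s (x - w)
              simpa only [sub_add_eq_add_sub] using this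
          _ = _ := one_mul _
    _ = volume S := lintegral_indicator_one hSm
    _ ≤ ENNReal.ofReal (2 * L) + ENNReal.ofReal (2 * L) := by
        refine (measure_union_le _ _).trans (le_of_eq ?_)
        rw [Real.volume_Icc, Real.volume_Icc]
        congr 2 <;> ring
    _ = 4 * ENNReal.ofReal L := by
        rw [ENNReal.ofReal_mul (by norm_num), ENNReal.ofReal_ofNat, ← two_mul, ← mul_assoc]
        norm_num

lemma const_bound (p : ℝ) (hp : 1 ≤ p) (l : ENNReal) :
    (4 * l) ^ (p - 1) * (2 * l) ≤ (2 ^ p * l) ^ p := by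
  have hp0 : 0 ≤ p := by linarith
  rw [ENNReal.mul_rpow_of_nonneg _ _ (by linarith), ENNReal.mul_rpow_of_nonneg _ _ hp0]
  have e1 : l ^ p = l ^ (p - 1) * l := by
    conv_rhs => rw [← ENNReal.rpow_one l, ← ENNReal.rpow_mul, one_mul]
    rw [← ENNReal.rpow_add_of_nonneg _ _ (by linarith) (by norm_num)]
    congr 1; ring
  have e2 : (4 : ENNReal) ^ (p - 1) * 2 = 2 ^ (2 * (p - 1) + 1) := by
    rw [ENNReal.rpow_add _ _ (by norm_num) (by norm_num), ENNReal.rpow_mul, ENNReal.rpow_one]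
    congr 2
    rw [ENNReal.rpow_ofNat]; norm_num
  calc (4 : ENNReal) ^ (p - 1) * l ^ (p - 1) * (2 * l)
      = (4 ^ (p - 1) * 2) * (l ^ (p - 1) * l) := by ring
    _ = 2 ^ (2 * (p - 1) + 1) * l ^ p := by rw [e2, e1]
    _ ≤ 2 ^ (p * p) * l ^ p := by
        gcongr
        · norm_num
        · nlinarith [sq_nonneg (p - 1)]
    _ = _ := by rw [ENNReal.rpow_mul]

lemma diff_bound {f : ℝ → ℂ} (hf : GoodSpline f) {p : ℝ} (hp : 1 ≤ p) {y : ℤ → ℝ} {L : ℝ}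
    (h : ∀ k : ℤ, |y k - k| ≤ L) (s : Finset ℤ) (c : ℤ → ℂ) :
    eLpNorm (fun t => ∑ k ∈ s, c k • (conv f rect (t + y k) - conv f rect (t + k)))
      (ENNReal.ofReal p) volume ≤
    2 ^ p * ENNReal.ofReal L * (∑ k ∈ s, ‖c k‖ₑ ^ p) ^ (1 / p) := by
  have hp0 : 0 < p := by linarith
  set l := ENNReal.ofReal L with hl
  set D : ℝ → ℂ := fun t => ∑ k ∈ s, c k • (conv f rect (t + y k) - conv f rect (t + k)) with hD
  have hpt : ∀ t, ‖D t‖ₑ ^ p ≤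
      (4 * l) ^ (p - 1) * ∑ k ∈ s, majK f (y k - k) (t + k) * ‖c k‖ₑ ^ p := by
    intro t
    have h1 : ‖D t‖ₑ ≤ ∑ k ∈ s, majK f (y k - k) (t + k) * ‖c k‖ₑ := by
      refine (enorm_sum_le _ _).trans (Finset.sum_le_sum fun k _ => ?_)
      rw [enorm_smul, mul_comm]
      gcongr
      have := diff_le_majK hf (y k - k) (t + k)
      rwa [show t + (k : ℝ) + (y k - k) = t + y k by ring] at this
    have h2 := ENNReal.inner_le_weight_mul_Lp_of_nonneg s hp
      (fun k => majK f (y k - k) (t + k)) (fun k => ‖c k‖ₑ)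
    have h3 := h1.trans h2
    calc ‖D t‖ₑ ^ p ≤ _ := ENNReal.rpow_le_rpow h3 hp0.le
      _ = (∑ k ∈ s, majK f (y k - k) (t + k)) ^ (p - 1) *
            ∑ k ∈ s, majK f (y k - k) (t + k) * ‖c k‖ₑ ^ p := by
          rw [ENNReal.mul_rpow_of_nonneg _ _ hp0.le, ← ENNReal.rpow_mul, ← ENNReal.rpow_mul,
            inv_mul_cancel₀ hp0.ne', ENNReal.rpow_one]
          congr 2
          field_simp
      _ ≤ _ := by
          gcongr
          exact majK_sum hf h s t
  have hint : ∫⁻ t, ‖D t‖ₑ ^ p ≤ (4 * l) ^ (p - 1) * (2 * l) * ∑ k ∈ s, ‖c k‖ₑ ^ p := by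
    calc ∫⁻ t, ‖D t‖ₑ ^ p
        ≤ ∫⁻ t, (4 * l) ^ (p - 1) * ∑ k ∈ s, majK f (y k - k) (t + k) * ‖c k‖ₑ ^ p :=
          lintegral_mono hpt
      _ = (4 * l) ^ (p - 1) * ∑ k ∈ s, (∫⁻ t, majK f (y k - k) t) * ‖c k‖ₑ ^ p := by
          have hm : ∀ k : ℤ, Measurable (fun t : ℝ => majK f (y k - k) (t + k)) :=
            fun k => (majK_measurable hf _).comp (by fun_prop)
          rw [lintegral_const_mul _ (Finset.measurable_fun_sum _ fun k _ => (hm k).mul_const _),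
            lintegral_finsetSum _ (fun k _ => (hm k).mul_const _)]
          congr 1
          apply Finset.sum_congr rfl
          intro k _
          rw [lintegral_mul_const _ (hm k),
            lintegral_add_right_eq_self (fun t => majK f (y k - k) t) (k : ℝ)]
      _ ≤ (4 * l) ^ (p - 1) * ∑ k ∈ s, (2 * l) * ‖c k‖ₑ ^ p := by
          gcongr with k _
          exact majK_lintegral hf (h k)
      _ = _ := by rw [← Finset.mul_sum]; ring
  rw [eLpNorm_eq_lintegral_rpow_enorm_toReal (by simpa using hp0) ENNReal.ofReal_ne_top,
    ENNReal.toReal_ofReal hp0.le]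
  calc (∫⁻ t, ‖D t‖ₑ ^ p) ^ (1 / p)
      ≤ ((2 ^ p * l) ^ p * ∑ k ∈ s, ‖c k‖ₑ ^ p) ^ (1 / p) := by
        apply ENNReal.rpow_le_rpow _ (by positivity)
        refine hint.trans ?_
        gcongr
        exact const_bound p hp l
    _ = _ := by
        rw [ENNReal.mul_rpow_of_nonneg _ _ (by positivity), ← ENNReal.rpow_mul,
          mul_one_div_cancel hp0.ne', ENNReal.rpow_one]

lemma sum_enorm_eq {p : ℝ} (hp : 1 ≤ p) (s : Finset ℤ) (c : ℤ → ℂ) :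
    (∑ k ∈ s, ‖c k‖ₑ ^ p) ^ (1 / p) = ENNReal.ofReal ((∑ k ∈ s, ‖c k‖ ^ p) ^ (1 / p)) := by
  have hp0 : 0 < p := by linarith
  rw [← ENNReal.ofReal_rpow_of_nonneg (by positivity) (by positivity),
    ENNReal.ofReal_sum_of_nonneg (fun k _ => by positivity)]
  congr 1
  apply Finset.sum_congr rfl
  intro k _
  rw [← ENNReal.ofReal_rpow_of_nonneg (norm_nonneg _) hp0.le, ofReal_norm]

/-- Corollary 4.10 of the paper. Let `β_m` (`m ≥ 1`) be the B-spline of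
order `m`, and suppose `{τ_k β_m}` is a `p`-Riesz basis of `V^p(β_m)` with lower constant
`A_p(m) > 0`. If `L = sup_k |y_k − k|` satisfies `L < 2^{−p} A_p(m)` (and `L < 1`), then
`{τ_{y_k} β_m}` is a `p`-Riesz basis of `V^p(β_m; Y)`. -/
theorem stmt16 (p : ℝ) (hp : 1 ≤ p)
    (m : ℕ) (hm : 1 ≤ m)
    (A : ℝ) (hA : 0 < A)
    (hbasis : ∃ B : ℝ, 0 < B ∧ IsPRieszBasis1 p (bspline m) (fun k => (k : ℝ)) A B)
    (y : ℤ → ℝ) (L : ℝ) (hL0 : 0 ≤ L) (hL : ∀ k : ℤ, |y k - k| ≤ L)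
    (hcond : L < 2 ^ (-p) * A) (hL1 : L < 1) :
    ∃ A' B' : ℝ, 0 < A' ∧ 0 < B' ∧ IsPRieszBasis1 p (bspline m) y A' B' := by
  obtain ⟨B, hB, hR⟩ := hbasis
  obtain ⟨n, rfl⟩ : ∃ n, m = n + 1 := ⟨m - 1, by omega⟩
  have hp0 : 0 < p := by linarith
  have h2p : (0 : ℝ) < 2 ^ p := by positivity
  set C : ℝ := 2 ^ p * L with hC
  have hC0 : 0 ≤ C := by positivity
  have hCA : C < A := by
    rw [Real.rpow_neg (by norm_num), ← div_eq_inv_mul, lt_div_iff₀ h2p] at hcond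
    rw [hC, mul_comm]; exact hcond
  have hCe : (2 : ENNReal) ^ p * ENNReal.ofReal L = ENNReal.ofReal C := by
    rw [hC, ENNReal.ofReal_mul h2p.le, ← ENNReal.ofReal_rpow_of_nonneg (by norm_num) hp0.le,
      ENNReal.ofReal_ofNat]
  refine ⟨A - C, B + C, by linarith, by linarith, ?_⟩
  intro s c
  obtain ⟨hlo, hup⟩ := hR s c
  have hbm : Measurable (bspline (n + 1)) := (good_bspline (n + 1)).1
  have hd := diff_bound (good_bspline n) hp hL s c
  rw [sum_enorm_eq hp, hCe, ← ENNReal.ofReal_mul hC0] at hd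
  change eLpNorm (fun t => ∑ k ∈ s, c k • (bspline (n + 1) (t + y k) - bspline (n + 1) (t + k)))
      (ENNReal.ofReal p) volume ≤ _ at hd
  set N : ℝ := (∑ k ∈ s, ‖c k‖ ^ p) ^ (1 / p) with hN
  have hN0 : 0 ≤ N := by positivity
  set F : ℝ → ℂ := fun t => ∑ k ∈ s, c k • bspline (n + 1) (t + (k : ℝ)) with hF
  set G : ℝ → ℂ := fun t => ∑ k ∈ s, c k • bspline (n + 1) (t + y k) with hG
  have hDe : (fun t => ∑ k ∈ s, c k • (bspline (n + 1) (t + y k) - bspline (n + 1) (t + k)))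
      = G - F := by
    ext t
    simp [hF, hG, mul_sub, Finset.sum_sub_distrib]
  rw [hDe] at hd
  have hFm : AEStronglyMeasurable F volume := by
    apply Measurable.aestronglyMeasurable
    rw [hF]; fun_prop
  have hGm : AEStronglyMeasurable G volume := by
    apply Measurable.aestronglyMeasurable
    rw [hG]; fun_prop
  have hp1 : 1 ≤ ENNReal.ofReal p := by simpa using hp
  constructor
  · have h1 : eLpNorm F (ENNReal.ofReal p) volume ≤
        eLpNorm G (ENNReal.ofReal p) volume + eLpNorm (G - F) (ENNReal.ofReal p) volume := by
      have := eLpNorm_sub_le hGm (hGm.sub hFm) hp1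
      rwa [sub_sub_cancel] at this
    have h2 := hlo.trans (h1.trans (add_le_add_right hd _))
    rw [sub_mul, ENNReal.ofReal_sub _ (by positivity)]
    exact tsub_le_iff_right.2 h2
  · have h1 : eLpNorm G (ENNReal.ofReal p) volume ≤
        eLpNorm F (ENNReal.ofReal p) volume + eLpNorm (G - F) (ENNReal.ofReal p) volume := by
      have := eLpNorm_add_le hFm (hGm.sub hFm) hp1
      rwa [add_sub_cancel] at this
    rw [add_mul, ENNReal.ofReal_add (by positivity) (by positivity)]
    exact h1.trans (add_le_add hup hd)
end
end

section
/- Let sinc(x) = sin(πx)/(πx) (with sinc(0) = 1), and let Y = {y_n}_{n∈ℤ} ⊂ ℝ satisfy sup_n |y_n − n| ≤ δ for some δ < 1/4. Then {sinc(· − y_n)}_{n∈ℤ} is a Riesz basis of V^2(sinc), and V^2(sinc; Y) = V^2(sinc). -/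
open MeasureTheory Filter Topology

noncomputable section

/-- `f` belongs to the `L²(ℝ)`-closure of the span of the translates `ψ(· − y_n)`, i.e. to
`V²(ψ; Y)`. -/
def InV2 (ψ : ℝ → ℂ) (y : ℤ → ℝ) (f : ℝ → ℂ) : Prop :=
  ∀ ε : ℝ, 0 < ε → ∃ (s : Finset ℤ) (c : ℤ → ℂ),
    eLpNorm (fun t => f t - ∑ n ∈ s, c n • ψ (t - y n)) 2 volume < ENNReal.ofReal ε


namespace Kadec

/-- The circle `ℝ/ℤ`. -/
abbrev Cr := AddCircle (1 : ℝ)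

/-- Haar probability measure on the circle. -/
abbrev hm : Measure Cr := AddCircle.haarAddCircle

/-- representative in `(-1/2, 1/2]` -/
def rep (x : Cr) : ℝ := (AddCircle.equivIoc (1 : ℝ) (-1/2) x : ℝ)

lemma measurable_rep : Measurable rep :=
  measurable_subtype_coe.comp (AddCircle.measurableEquivIoc (1 : ℝ) (-1/2)).measurable

lemma rep_mem (x : Cr) : rep x ∈ Set.Ioc (-1/2 : ℝ) (-1/2 + 1) :=
  (AddCircle.equivIoc (1 : ℝ) (-1/2) x).2

lemma coe_rep (x : Cr) : ((rep x : ℝ) : Cr) = x :=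
  AddCircle.coe_equivIoc ..

/-- the exponential -/
def ex (a x : ℝ) : ℂ := Complex.exp (2 * Real.pi * Complex.I * a * x)

lemma ex_add (a b x : ℝ) : ex (a + b) x = ex a x * ex b x := by
  unfold ex; rw [← Complex.exp_add]; congr 1; push_cast; ring

lemma norm_ex (a x : ℝ) : ‖ex a x‖ = 1 := by
  unfold ex
  rw [show (2 * Real.pi * Complex.I * a * x : ℂ) = ((2 * Real.pi * a * x : ℝ) : ℂ) * Complex.I by
    push_cast; ring]
  exact Complex.norm_exp_ofReal_mul_I _

lemma continuous_ex (a : ℝ) : Continuous (ex a) := by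
  unfold ex; fun_prop

def E (a : ℝ) (x : Cr) : ℂ := ex a (rep x)

lemma E_add (a b : ℝ) (x : Cr) : E (a + b) x = E a x * E b x := ex_add _ _ _

lemma norm_E (a : ℝ) (x : Cr) : ‖E a x‖ = 1 := norm_ex _ _

lemma measurable_E (a : ℝ) : Measurable (E a) :=
  (continuous_ex a).measurable.comp measurable_rep

lemma E_int (n : ℤ) (x : Cr) : E n x = fourier n x := by
  conv_rhs => rw [← coe_rep x]
  rw [fourier_coe_apply]
  unfold E ex
  congr 1; push_cast; simp

lemma E_eq_lift (a : ℝ) : E a = AddCircle.liftIoc (1 : ℝ) (-1/2) (ex a) := rfl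

lemma integral_ex (a : ℝ) : ∫ x in (-1/2 : ℝ)..(1/2), ex a x = (sinc a : ℝ) := by
  unfold sinc
  split_ifs with h
  · subst h; simp [ex]; norm_num
  · have hc : (2 * Real.pi * Complex.I * a : ℂ) ≠ 0 := by
      simp [h, Real.pi_ne_zero]
    unfold ex
    rw [integral_exp_mul_complex hc]
    push_cast
    rw [Complex.sin]
    have hπ : (Real.pi : ℂ) ≠ 0 := by simp [Real.pi_ne_zero]
    have ha : (a : ℂ) ≠ 0 := by simp [h]
    have e1 : (2 * Real.pi * Complex.I * a * (1/2) : ℂ) = Real.pi * a * Complex.I := by ring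
    have e2 : (2 * Real.pi * Complex.I * a * (-1/2) : ℂ) = - (Real.pi * a) * Complex.I := by ring
    rw [e1, e2]
    field_simp
    rw [Complex.I_sq]
    ring

lemma fourierCoeff_lift (f : ℝ → ℂ) (n : ℤ) :
    fourierCoeff (AddCircle.liftIoc (1 : ℝ) (-1/2) f) n =
      ∫ x in (-1/2 : ℝ)..(1/2), ex (-n) x * f x := by
  rw [fourierCoeff_liftIoc_eq, fourierCoeffOn_eq_integral]
  have h1 : (-1/2 : ℝ) + 1 = 1/2 := by norm_num
  rw [h1]
  have h2 : (1/2 : ℝ) - (-1/2) = 1 := by norm_num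
  rw [h2]
  simp only [div_one, one_smul]
  apply intervalIntegral.integral_congr
  intro x _
  simp only [fourier_coe_apply, smul_eq_mul]
  unfold ex
  congr 2; push_cast; ring

lemma fourierCoeff_E (a : ℝ) (n : ℤ) : fourierCoeff (E a) n = (sinc (a - n) : ℝ) := by
  rw [E_eq_lift, fourierCoeff_lift, ← integral_ex]
  apply intervalIntegral.integral_congr
  intro x _
  simp only
  rw [← ex_add]; congr 1; ring

lemma memLp_E (a : ℝ) : MemLp (E a) 2 hm :=
  MemLp.of_bound (measurable_E a).aestronglyMeasurable 1
    (Eventually.of_forall fun x => (norm_E a x).le)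

/-- the exponential in `L²` -/
def EL (a : ℝ) : Lp ℂ 2 hm := (memLp_E a).toLp

lemma coeFn_EL (a : ℝ) : EL a =ᵐ[hm] E a := (memLp_E a).coeFn_toLp

lemma EL_int (n : ℤ) : EL n = fourierLp 2 n := by
  apply Lp.ext
  filter_upwards [coeFn_EL n, coeFn_fourierLp (T := 1) 2 n] with x h1 h2
  rw [h1, h2, E_int]

lemma coeFn_sum {ι : Type*} (s : Finset ι) (c : ι → ℂ) (a : ι → ℝ) :
    ((∑ i ∈ s, c i • EL (a i) : Lp ℂ 2 hm) : Cr → ℂ) =ᵐ[hm] fun x => ∑ i ∈ s, c i * E (a i) x := by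
  classical
  induction s using Finset.induction_on with
  | empty => simp only [Finset.sum_empty]; exact Lp.coeFn_zero ℂ 2 hm
  | insert i s hi ih =>
    simp_rw [Finset.sum_insert hi]
    filter_upwards [Lp.coeFn_add (c i • EL (a i)) (∑ i ∈ s, c i • EL (a i)), ih,
      Lp.coeFn_smul (c i) (EL (a i)), coeFn_EL (a i)] with x h1 h2 h3 h4
    rw [h1, Pi.add_apply, h2, h3, Pi.smul_apply, h4, smul_eq_mul]

lemma norm_sum_EL {ι : Type*} (s : Finset ι) (c : ι → ℂ) (a : ι → ℝ) :
    ENNReal.ofReal ‖∑ i ∈ s, c i • EL (a i)‖ = eLpNorm (fun x => ∑ i ∈ s, c i * E (a i) x) 2 hm := by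
  rw [Lp.norm_def, ENNReal.ofReal_toReal (Lp.eLpNorm_ne_top _)]
  exact eLpNorm_congr_ae (coeFn_sum s c a)

lemma norm_shift {ι : Type*} (s : Finset ι) (c : ι → ℂ) (a : ι → ℝ) (r : ℝ) :
    ‖∑ i ∈ s, c i • EL (a i - r)‖ = ‖∑ i ∈ s, c i • EL (a i)‖ := by
  have : ENNReal.ofReal ‖∑ i ∈ s, c i • EL (a i - r)‖ = ENNReal.ofReal ‖∑ i ∈ s, c i • EL (a i)‖ := by
    rw [norm_sum_EL, norm_sum_EL]
    apply eLpNorm_congr_norm_ae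
    refine Eventually.of_forall fun x => ?_
    have : ∑ i ∈ s, c i * E (a i - r) x = E (-r) x * ∑ i ∈ s, c i * E (a i) x := by
      rw [Finset.mul_sum]
      refine Finset.sum_congr rfl fun i _ => ?_
      rw [sub_eq_add_neg, E_add]; ring
    rw [this, norm_mul, norm_E, one_mul]
  rwa [ENNReal.ofReal_eq_ofReal_iff (norm_nonneg _) (norm_nonneg _)] at this

lemma fourierCoeff_sum {ι : Type*} (s : Finset ι) (c : ι → ℂ) (a : ι → ℝ) (m : ℤ) :
    fourierCoeff (∑ i ∈ s, c i • EL (a i) : Lp ℂ 2 hm) m = ∑ i ∈ s, c i * (sinc (a i - m) : ℝ) := by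
  rw [fourierCoeff_congr_ae (coeFn_sum s c a)]
  have : (fun x => ∑ i ∈ s, c i * E (a i) x) = ∑ i ∈ s, fun x => c i * E (a i) x := by
    ext x; simp
  rw [this, fourierCoeff.sum]
  · rw [Finset.sum_apply]
    refine Finset.sum_congr rfl fun i _ => ?_
    rw [fourierCoeff.const_mul, fourierCoeff_E]
  · intro i _
    exact ((memLp_E (a i)).integrable (by norm_num)).const_mul _

lemma tsum_fourier (f : Lp ℂ 2 hm) :
    ∑' m : ℤ, ‖fourierCoeff f m‖ₑ ^ 2 = ENNReal.ofReal (‖f‖ ^ 2) := by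
  have h := hasSum_sq_fourierCoeff f
  have h2 : ∫ t, ‖f t‖ ^ 2 ∂hm = ‖f‖ ^ 2 := by
    have h3 := L2.inner_def (𝕜 := ℂ) f f
    rw [inner_self_eq_norm_sq_to_K] at h3
    have h4 : (fun t => inner ℂ (f t) (f t)) = fun t => ((‖f t‖ ^ 2 : ℝ) : ℂ) := by
      ext t; rw [inner_self_eq_norm_sq_to_K]; simp
    rw [h4, integral_complex_ofReal] at h3
    apply Complex.ofReal_injective
    rw [Complex.ofReal_pow]
    exact h3.symm
  rw [h2] at h
  rw [← h.tsum_eq, ENNReal.ofReal_tsum_of_nonneg (fun _ => by positivity) h.summable]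
  refine tsum_congr fun m => ?_
  rw [ENNReal.ofReal_pow (norm_nonneg _), ofReal_norm]

lemma sinc_neg (x : ℝ) : sinc (-x) = sinc x := by
  unfold sinc; simp

lemma measurable_sinc : Measurable sinc := by
  unfold sinc
  refine Measurable.ite (measurableSet_singleton 0) measurable_const ?_
  fun_prop

lemma lintegral_periodize (g : ℝ → ENNReal) (hg : Measurable g) :
    ∫⁻ t, g t = ∫⁻ r in Set.Ioc (0 : ℝ) 1, ∑' m : ℤ, g (r + m) := by
  rw [lintegral_tsum (f := fun (m : ℤ) (r : ℝ) => g (r + m)) (fun m => (hg.comp (measurable_id.add_const _)).aemeasurable)]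
  have h := Set.pairwise_disjoint_Ioc_intCast ℝ
  rw [← setLIntegral_univ, ← iUnion_Ioc_intCast ℝ,
    lintegral_iUnion (fun _ => measurableSet_Ioc) h]
  refine tsum_congr fun m => ?_
  have mp := (measurePreserving_add_right (volume : Measure ℝ) (m : ℝ)).setLIntegral_comp_preimage
    (measurableSet_Ioc (a := (m : ℝ)) (b := m + 1)) hg
  rw [← mp]
  congr 2
  ext x; simp

theorem plancherel {ι : Type*} (s : Finset ι) (c : ι → ℂ) (a : ι → ℝ) :
    eLpNorm (fun t => ∑ i ∈ s, c i * ((sinc (t - a i) : ℝ) : ℂ)) 2 volume =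
      ENNReal.ofReal ‖∑ i ∈ s, c i • EL (a i)‖ := by
  have hm : Measurable (fun t => ∑ i ∈ s, c i * ((sinc (t - a i) : ℝ) : ℂ)) := by
    refine Finset.measurable_fun_sum _ fun i _ => ?_
    exact (Complex.measurable_ofReal.comp
      (measurable_sinc.comp (measurable_id.sub_const _))).const_mul _
  rw [eLpNorm_eq_lintegral_rpow_enorm_toReal (by norm_num) (by norm_num)]
  simp only [ENNReal.toReal_ofNat, ENNReal.rpow_ofNat]
  rw [lintegral_periodize _ (hm.enorm.pow_const 2)]
  have key : ∀ r : ℝ, ∑' m : ℤ, ‖∑ i ∈ s, c i * ((sinc (r + m - a i) : ℝ) : ℂ)‖ₑ ^ 2 =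
      ENNReal.ofReal (‖∑ i ∈ s, c i • EL (a i)‖ ^ 2) := by
    intro r
    rw [← norm_shift s c a r, ← tsum_fourier]
    refine tsum_congr fun m => ?_
    rw [fourierCoeff_sum]
    congr 2
    refine Finset.sum_congr rfl fun i _ => ?_
    rw [← sinc_neg]; congr 3; ring
  simp_rw [key]
  simp only [lintegral_const, Measure.restrict_apply MeasurableSet.univ, Set.univ_inter,
    Real.volume_Ioc, sub_zero, ENNReal.ofReal_one, mul_one]
  rw [ENNReal.ofReal_rpow_of_nonneg (by positivity) (by norm_num), ← Real.sqrt_eq_rpow,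
    Real.sqrt_sq (norm_nonneg _)]

/-- cosine coefficients -/
def cA (d : ℝ) (k : ℤ) : ℝ :=
  if k = 0 then 1 - sinc d else d * Real.sin (Real.pi * d) / (Real.pi * ((k : ℝ) ^ 2 - d ^ 2))

/-- sine coefficients -/
def sB (d : ℝ) (k : ℤ) : ℝ :=
  d * Real.cos (Real.pi * d) / (Real.pi * (((k : ℝ) - 1/2) ^ 2 - d ^ 2))

lemma int_sq {k : ℤ} (hk : k ≠ 0) : (1 : ℝ) ≤ (k : ℝ) ^ 2 := by
  have : 1 ≤ k ^ 2 := by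
    have := pow_pos (abs_pos.mpr hk) 2
    rw [sq_abs] at this; omega
  exact_mod_cast this

lemma int_half_sq (k : ℤ) : (1/4 : ℝ) ≤ ((k : ℝ) - 1/2) ^ 2 := by
  have : 0 ≤ k * (k - 1) := by
    rcases le_or_gt k 0 with h | h
    · nlinarith
    · nlinarith
  have : (0 : ℝ) ≤ k * (k - 1) := by exact_mod_cast this
  nlinarith

lemma sq_le' {d : ℝ} (hd : |d| ≤ 1/4) : d ^ 2 ≤ 1/16 := by
  rw [← sq_abs]; nlinarith [abs_nonneg d]

lemma sinc_zero : sinc 0 = 1 := by simp [sinc]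

lemma sinc_of_ne {x : ℝ} (h : x ≠ 0) : sinc x = Real.sin (Real.pi * x) / (Real.pi * x) := by
  simp [sinc, h]

lemma coefA {d : ℝ} (hd : |d| ≤ 1/4) (k : ℤ) :
    (if k = 0 then 1 else 0) - (sinc (d - k) + sinc (d + k)) / 2 = (-1) ^ k * cA d k := by
  unfold cA
  split_ifs with h
  · subst h; simp
  · have h1 := int_sq h
    have h2 := sq_le' hd
    have e1 : d - k ≠ 0 := by
      intro e; have : d = k := by linarith
      rw [this] at h2; linarith
    have e2 : d + k ≠ 0 := by
      intro e; have : d = -k := by linarith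
      rw [this] at h2; nlinarith
    rw [sinc_of_ne e1, sinc_of_ne e2]
    have s1 : Real.sin (Real.pi * (d - k)) = (-1) ^ k * Real.sin (Real.pi * d) := by
      rw [mul_sub, mul_comm Real.pi (k : ℝ)]
      exact Real.sin_sub_int_mul_pi _ _
    have s2 : Real.sin (Real.pi * (d + k)) = (-1) ^ k * Real.sin (Real.pi * d) := by
      rw [mul_add, mul_comm Real.pi (k : ℝ)]
      exact Real.sin_add_int_mul_pi _ _
    rw [s1, s2]
    have e3 : (k : ℝ) ^ 2 - d ^ 2 ≠ 0 := by linarith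
    have hπ := Real.pi_ne_zero
    field_simp
    ring

lemma coefB {d : ℝ} (hd : |d| ≤ 1/4) (k : ℤ) :
    (sinc (d - k + 1/2) - sinc (d + k - 1/2)) / 2 = - ((-1) ^ k * sB d k) := by
  unfold sB
  have h1 := int_half_sq k
  have h2 := sq_le' hd
  have e1 : d - k + 1/2 ≠ 0 := by
    intro e; have : d = k - 1/2 := by linarith
    rw [this] at h2; linarith
  have e2 : d + k - 1/2 ≠ 0 := by
    intro e; have : d = -(k - 1/2) := by linarith
    rw [this] at h2; nlinarith
  rw [sinc_of_ne e1, sinc_of_ne e2]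
  have s1 : Real.sin (Real.pi * (d - k + 1/2)) = (-1) ^ k * Real.cos (Real.pi * d) := by
    rw [show Real.pi * (d - k + 1/2) = Real.pi * d - k * Real.pi + Real.pi / 2 by ring,
      Real.sin_add_pi_div_two]
    exact Real.cos_sub_int_mul_pi _ _
  have s2 : Real.sin (Real.pi * (d + k - 1/2)) = -((-1) ^ k * Real.cos (Real.pi * d)) := by
    rw [show Real.pi * (d + k - 1/2) = Real.pi * d + k * Real.pi - Real.pi / 2 by ring,
      Real.sin_sub_pi_div_two]
    rw [Real.cos_add_int_mul_pi]
  rw [s1, s2]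
  have e3 : ((k : ℝ) - 1/2) ^ 2 - d ^ 2 ≠ 0 := by linarith
  have hπ := Real.pi_ne_zero
  generalize ((-1 : ℝ) ^ k) = σ
  rw [div_sub_div _ _ (by positivity) (by positivity), div_div, mul_div_assoc', ← neg_div, div_eq_div_iff (by positivity) (by positivity)]
  ring

lemma summable_inv_sq : Summable fun k : ℤ => (1 : ℝ) / (k : ℝ) ^ 2 :=
  Real.summable_one_div_int_pow.mpr one_lt_two

lemma summable_cA {d : ℝ} (hd : |d| ≤ 1/4) : Summable (cA d) := by
  refine Summable.of_norm_bounded_eventually (g := fun k : ℤ => (1 : ℝ) / (k : ℝ) ^ 2)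
    summable_inv_sq ?_
  filter_upwards [(Set.finite_singleton (0 : ℤ)).compl_mem_cofinite] with k hk
  have hk : k ≠ 0 := by simpa using hk
  have h1 := int_sq hk
  have h2 := sq_le' hd
  have hπ := Real.pi_gt_three
  simp only [cA, hk, if_false]
  rw [norm_div, norm_mul, Real.norm_eq_abs, Real.norm_eq_abs, Real.norm_eq_abs,
    abs_of_pos (a := Real.pi * _) (by apply mul_pos <;> linarith)]
  have : |d| * |Real.sin (Real.pi * d)| ≤ 1 := by
    have := Real.abs_sin_le_one (Real.pi * d)
    nlinarith [abs_nonneg d, abs_nonneg (Real.sin (Real.pi * d))]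
  apply div_le_div₀ zero_le_one this (by linarith)
  nlinarith

lemma summable_sB {d : ℝ} (hd : |d| ≤ 1/4) : Summable (sB d) := by
  refine Summable.of_norm_bounded_eventually (g := fun k : ℤ => 4 * ((1 : ℝ) / (k : ℝ) ^ 2))
    (summable_inv_sq.mul_left 4) ?_
  filter_upwards [(Set.finite_singleton (0 : ℤ)).compl_mem_cofinite] with k hk
  have hk : k ≠ 0 := by simpa using hk
  have h1 := int_sq hk
  have h1' := int_half_sq k
  have h2 := sq_le' hd
  have hπ := Real.pi_gt_three
  simp only [sB]
  have hk2 : (k : ℝ) ^ 2 ≤ 8 * (((k : ℝ) - 1/2) ^ 2 - d ^ 2) := by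
    have : 0 ≤ (k - 1) * (k - 1) := mul_self_nonneg _
    have h3 : 0 ≤ (k - 1) * (7 * k - 1) := by
      rcases le_or_gt k 0 with h | h
      · nlinarith
      · nlinarith
    have h4 : (0 : ℝ) ≤ (k - 1) * (7 * k - 1) := by exact_mod_cast h3
    nlinarith
  rw [norm_div, norm_mul, Real.norm_eq_abs, Real.norm_eq_abs, Real.norm_eq_abs,
    abs_of_pos (a := Real.pi * _) (by apply mul_pos <;> linarith), mul_one_div]
  have : |d| * |Real.cos (Real.pi * d)| ≤ 1 := by
    have := Real.abs_cos_le_one (Real.pi * d)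
    nlinarith [abs_nonneg d, abs_nonneg (Real.cos (Real.pi * d))]
  rw [div_le_div_iff₀ (by apply mul_pos <;> linarith) (by linarith)]
  nlinarith

lemma ex_neg (a x : ℝ) : ex (-a) x = (ex a x)⁻¹ := by
  unfold ex; rw [← Complex.exp_neg]; congr 1; push_cast; ring

lemma cos_eq (d x : ℝ) : (Real.cos (2 * Real.pi * d * x) : ℂ) = (ex d x + ex (-d) x) / 2 := by
  rw [Complex.ofReal_cos, Complex.cos]
  have e1 : ex d x = Complex.exp (((2 * Real.pi * d * x : ℝ) : ℂ) * Complex.I) := by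
    unfold ex; congr 1; push_cast; ring
  have e2 : ex (-d) x = Complex.exp (-((2 * Real.pi * d * x : ℝ) : ℂ) * Complex.I) := by
    unfold ex; congr 1; push_cast; ring
  rw [e1, e2]

lemma sin_eq (d x : ℝ) :
    (Real.sin (2 * Real.pi * d * x) : ℂ) = - Complex.I * (ex d x - ex (-d) x) / 2 := by
  rw [Complex.ofReal_sin, Complex.sin]
  have e1 : ex d x = Complex.exp (((2 * Real.pi * d * x : ℝ) : ℂ) * Complex.I) := by
    unfold ex; congr 1; push_cast; ring
  have e2 : ex (-d) x = Complex.exp (-((2 * Real.pi * d * x : ℝ) : ℂ) * Complex.I) := by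
    unfold ex; congr 1; push_cast; ring
  rw [e1, e2]; ring

lemma ex_half : ex (1/2) (1/2) = Complex.I := by
  unfold ex
  rw [show (2 * Real.pi * Complex.I * ((1/2 : ℝ) : ℂ) * ((1/2 : ℝ) : ℂ)) =
    Real.pi / 2 * Complex.I by push_cast; ring, Complex.exp_pi_div_two_mul_I]

lemma ex_neg_half : ex (1/2) (-1/2) = -Complex.I := by
  unfold ex
  rw [show (2 * Real.pi * Complex.I * ((1/2 : ℝ) : ℂ) * ((-1/2 : ℝ) : ℂ)) =
    -(Real.pi / 2) * Complex.I by push_cast; ring, neg_mul, Complex.exp_neg,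
    Complex.exp_pi_div_two_mul_I, Complex.inv_I]

lemma rep_half : rep ((1/2 : ℝ) : Cr) = 1/2 := by
  have h : (1/2 : ℝ) ∈ Set.Ioc (-1/2 : ℝ) (-1/2 + 1) := by constructor <;> norm_num
  have := AddCircle.liftIoc_coe_apply (p := (1:ℝ)) (a := -1/2) (f := fun x : ℝ => x) h
  exact this

lemma fourier_half (k : ℤ) : fourier k ((1/2 : ℝ) : Cr) = (-1 : ℂ) ^ k := by
  rw [fourier_coe_apply, ← Complex.exp_pi_mul_I, ← Complex.exp_int_mul]
  congr 1; push_cast; ring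

/-- generic pointwise Fourier expansion -/
lemma pointwise (f : ℝ → ℂ) (hf : Continuous f) (h : f (-1/2) = f (1/2)) (b : ℤ → ℂ)
    (hb : ∀ k : ℤ, ∫ x in (-1/2 : ℝ)..(1/2), ex (-k) x * f x = b k) (hs : Summable b) (x : Cr) :
    HasSum (fun k => b k * fourier k x) (f (rep x)) := by
  have hc : Continuous (AddCircle.liftIoc (1 : ℝ) (-1/2) f) := by
    apply AddCircle.liftIoc_continuous
    · rw [h]; norm_num
    · exact hf.continuousOn
  have hco : fourierCoeff (AddCircle.liftIoc (1 : ℝ) (-1/2) f) = b := by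
    ext k; rw [fourierCoeff_lift, hb]
  have := has_pointwise_sum_fourier_series_of_summable
    (f := (⟨_, hc⟩ : C(Cr, ℂ))) (by simpa [hco] using hs) x
  simp only [ContinuousMap.coe_mk, hco, smul_eq_mul] at this
  exact this

lemma ii (f : ℝ → ℂ) (hf : Continuous f) : IntervalIntegrable f volume (-1/2) (1/2) :=
  hf.intervalIntegrable _ _

lemma hasSum_cos {d : ℝ} (hd : |d| ≤ 1/4) (x : Cr) :
    HasSum (fun k : ℤ => (((-1) ^ k * cA d k : ℝ) : ℂ) * fourier k x)
      (1 - (Real.cos (2 * Real.pi * d * rep x) : ℂ)) := by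
  refine pointwise (fun x => 1 - (Real.cos (2 * Real.pi * d * x) : ℂ)) (by fun_prop) ?_ _ ?_ ?_ x
  · rw [← Real.cos_neg]; congr 3; ring
  · intro k
    rw [← coefA hd]
    have : ∀ x : ℝ, ex (-k) x * (1 - (Real.cos (2 * Real.pi * d * x) : ℂ)) =
        ex (-k) x - (1/2) * (ex (d - k) x + ex (-(d + k)) x) := by
      intro x
      rw [cos_eq, show d - k = -k + d by ring, show -(d + k) = -k + -d by ring, ex_add, ex_add]; ring
    simp_rw [this]
    have i1 := ii _ (continuous_ex (-k))
    have i2 := ii _ (continuous_ex (d-k))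
    have i3 := ii _ (continuous_ex (-(d+k)))
    rw [intervalIntegral.integral_sub i1 ((i2.add i3).const_mul _),
      intervalIntegral.integral_const_mul, intervalIntegral.integral_add i2 i3,
      integral_ex, integral_ex, integral_ex, sinc_neg, sinc_neg]
    have : sinc (k : ℝ) = if k = 0 then 1 else 0 := by
      split_ifs with h
      · subst h; simp [sinc_zero]
      · rw [sinc_of_ne (by exact_mod_cast h), mul_comm, Real.sin_int_mul_pi, zero_div]
    rw [this]; push_cast; ring
  · rw [Complex.summable_ofReal]
    apply Summable.of_norm
    simpa using (summable_cA hd).norm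

lemma hasSum_sin {d : ℝ} (hd : |d| ≤ 1/4) (x : Cr) :
    HasSum (fun k : ℤ => (Complex.I * ((-1) ^ k * sB d k : ℝ) : ℂ) * fourier k x)
      ((Real.sin (2 * Real.pi * d * rep x) : ℂ) * E (1/2) x) := by
  refine pointwise (fun x => (Real.sin (2 * Real.pi * d * x) : ℂ) * ex (1/2) x) ?_ ?_ _ ?_ ?_ x
  · have := continuous_ex (1/2)
    fun_prop
  · rw [ex_half, ex_neg_half, show 2 * Real.pi * d * (-1/2) = -(2 * Real.pi * d * (1/2)) by ring, Real.sin_neg]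
    push_cast; ring
  · intro k
    have hc := coefB hd k
    have : ∀ x : ℝ, ex (-k) x * ((Real.sin (2 * Real.pi * d * x) : ℂ) * ex (1/2) x) =
        (-Complex.I/2) * (ex (d - k + 1/2) x - ex (-(d + k - 1/2)) x) := by
      intro x
      rw [sin_eq, show d - k + 1/2 = -k + d + 1/2 by ring,
        show -(d + k - 1/2) = -k + -d + 1/2 by ring, ex_add, ex_add, ex_add, ex_add]; ring
    simp_rw [this]
    have i2 := ii _ (continuous_ex (d-k+1/2))
    have i3 := ii _ (continuous_ex (-(d+k-1/2)))
    rw [intervalIntegral.integral_const_mul, intervalIntegral.integral_sub i2 i3,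
      integral_ex, integral_ex, sinc_neg]
    have hc' : (-1) ^ k * sB d k = - ((sinc (d - k + 1/2) - sinc (d + k - 1/2)) / 2) := by
      rw [hc]; ring
    rw [hc']; push_cast; ring
  · apply Summable.mul_left
    rw [Complex.summable_ofReal]
    apply Summable.of_norm
    simpa using (summable_sB hd).norm

lemma hasSum_cA {d : ℝ} (hd : |d| ≤ 1/4) : HasSum (cA d) (1 - Real.cos (Real.pi * d)) := by
  have := hasSum_cos hd ((1/2 : ℝ) : Cr)
  rw [rep_half] at this
  simp_rw [fourier_half] at this
  rw [← Complex.hasSum_ofReal]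
  convert this using 1
  · ext k
    push_cast
    rw [mul_right_comm, ← mul_zpow]; simp
  · push_cast; congr 2; ring

lemma hasSum_sB {d : ℝ} (hd : |d| ≤ 1/4) : HasSum (sB d) (Real.sin (Real.pi * d)) := by
  have := hasSum_sin hd ((1/2 : ℝ) : Cr)
  unfold E at this
  rw [rep_half] at this
  simp_rw [fourier_half] at this
  rw [ex_half] at this
  have := this.mul_left (-Complex.I)
  rw [← Complex.hasSum_ofReal]
  have h1 : (fun k : ℤ => ((sB d k : ℝ) : ℂ)) =
      fun i : ℤ => -Complex.I * (Complex.I * (((-1) ^ i * sB d i : ℝ) : ℂ) * (-1) ^ i) := by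
    ext k
    push_cast
    have : (-1 : ℂ) ^ k * (-1) ^ k = 1 := by rw [← mul_zpow]; simp
    linear_combination (-(sB d k : ℂ)) * this + (-1 : ℂ) ^ k * (-1) ^ k * (sB d k : ℂ) * Complex.I_sq
  have h2 : ((Real.sin (Real.pi * d) : ℝ) : ℂ) =
      -Complex.I * (((Real.sin (2 * Real.pi * d * (1 / 2)) : ℝ) : ℂ) * Complex.I) := by
    rw [show Real.pi * d = 2 * Real.pi * d * (1/2) by ring]
    linear_combination ((Real.sin (2 * Real.pi * d * (1/2)) : ℝ) : ℂ) * Complex.I_sq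
  rw [h1, h2]
  exact this

lemma sinc_mono {d δ : ℝ} (h0 : 0 ≤ d) (h1 : d ≤ δ) (h2 : δ ≤ 1/4) : sinc δ ≤ sinc d ∧ sinc d ≤ 1 := by
  have hπ := Real.pi_pos
  have le1 : ∀ x : ℝ, 0 ≤ x → sinc x ≤ 1 := by
    intro x hx
    rcases hx.eq_or_lt with rfl | hx
    · rw [sinc_zero]
    · rw [sinc_of_ne hx.ne', div_le_one (by positivity)]
      exact Real.sin_le (by positivity)
  refine ⟨?_, le1 d h0⟩
  rcases h0.eq_or_lt with rfl | hd
  · rw [sinc_zero]; exact le1 δ h1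
  have hδ : 0 < δ := by linarith
  have hc := strictConcaveOn_sin_Icc.concaveOn.2
    (show (0 : ℝ) ∈ Set.Icc 0 Real.pi from ⟨le_rfl, hπ.le⟩)
    (show Real.pi * δ ∈ Set.Icc 0 Real.pi from ⟨by positivity, by nlinarith⟩)
    (show 0 ≤ 1 - d / δ by rw [sub_nonneg, div_le_one hδ]; exact h1)
    (show 0 ≤ d / δ by positivity) (by ring)
  simp only [smul_eq_mul, mul_zero, Real.sin_zero, zero_add] at hc
  rw [show d / δ * (Real.pi * δ) = Real.pi * d by field_simp] at hc
  rw [sinc_of_ne hδ.ne', sinc_of_ne hd.ne', div_le_div_iff₀ (by positivity) (by positivity)]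
  have : Real.sin (Real.pi * δ) * d ≤ Real.sin (Real.pi * d) * δ := by
    rw [div_mul_eq_mul_div, div_le_iff₀ hδ] at hc; linarith
  nlinarith

lemma cA_abs (d : ℝ) (k : ℤ) : cA |d| k = cA d k := by
  rcases abs_choice d with h | h <;> rw [h]
  unfold cA
  rw [sinc_neg]; simp

lemma sB_abs (d : ℝ) (k : ℤ) : |sB d k| = |sB |d| k| := by
  rcases abs_choice d with h | h <;> rw [h]
  unfold sB
  rw [← abs_neg]; congr 1
  simp [neg_div]

lemma abs_cA_le {d δ : ℝ} (h1 : |d| ≤ δ) (h2 : δ ≤ 1/4) (k : ℤ) : |cA d k| ≤ cA δ k := by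
  rw [← cA_abs d]
  have h0 := abs_nonneg d
  generalize |d| = d at *
  have hπ := Real.pi_pos
  unfold cA
  split_ifs with h
  · have := sinc_mono h0 h1 h2
    rw [abs_of_nonneg (by linarith)]; linarith
  · have hk := int_sq h
    have s0 : 0 ≤ Real.sin (Real.pi * d) := Real.sin_nonneg_of_nonneg_of_le_pi (by positivity) (by nlinarith)
    have s1 : Real.sin (Real.pi * d) ≤ Real.sin (Real.pi * δ) :=
      Real.sin_le_sin_of_le_of_le_pi_div_two (by nlinarith) (by nlinarith) (by nlinarith)
    rw [abs_of_nonneg (div_nonneg (by positivity) (mul_nonneg hπ.le (by nlinarith)))]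
    apply div_le_div₀
    · apply mul_nonneg <;> linarith
    · apply mul_le_mul h1 s1 s0 (by linarith)
    · apply mul_pos hπ; nlinarith
    · apply mul_le_mul_of_nonneg_left _ hπ.le; nlinarith

lemma xcos_mono {d δ : ℝ} (h0 : 0 ≤ d) (h1 : d ≤ δ) (h2 : δ ≤ 1/4) :
    d * Real.cos (Real.pi * d) ≤ δ * Real.cos (Real.pi * δ) := by
  have hπ := Real.pi_pos
  have hπ4 := Real.pi_le_four
  have c1 : Real.cos (Real.pi / 4) ≤ Real.cos (Real.pi * δ) :=
    Real.cos_le_cos_of_nonneg_of_le_pi (by nlinarith) (by linarith) (by nlinarith)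
  have hs : Real.sin (Real.pi / 4) = Real.cos (Real.pi / 4) := by
    rw [Real.sin_pi_div_four, Real.cos_pi_div_four]
  have hc : 0 < Real.cos (Real.pi / 4) := by rw [Real.cos_pi_div_four]; positivity
  have key : Real.cos (Real.pi * d) - Real.cos (Real.pi * δ) ≤
      Real.cos (Real.pi / 4) * (Real.pi * (δ - d)) := by
    rw [Real.cos_sub_cos]
    have e : Real.sin ((Real.pi * d - Real.pi * δ) / 2) = - Real.sin (Real.pi * (δ - d) / 2) := by
      rw [← Real.sin_neg]; congr 1; ring
    rw [e]
    have a1 : Real.sin (Real.pi * (δ - d) / 2) ≤ Real.pi * (δ - d) / 2 :=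
      Real.sin_le (by have : 0 ≤ δ - d := by linarith
                      positivity)
    have a0 : 0 ≤ Real.sin (Real.pi * (δ - d) / 2) :=
      Real.sin_nonneg_of_nonneg_of_le_pi (by have : 0 ≤ δ - d := by linarith
                                             positivity) (by nlinarith)
    have a2 : Real.sin ((Real.pi * d + Real.pi * δ) / 2) ≤ Real.cos (Real.pi / 4) := by
      rw [← hs]
      exact Real.sin_le_sin_of_le_of_le_pi_div_two (by nlinarith) (by linarith) (by nlinarith)
    have := mul_le_mul a2 a1 a0 hc.le
    nlinarith
  have k2 : d * (Real.cos (Real.pi * d) - Real.cos (Real.pi * δ)) ≤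
      (1/4) * (Real.cos (Real.pi / 4) * (4 * (δ - d))) := by
    have p : 0 ≤ δ - d := by linarith
    calc _ ≤ d * (Real.cos (Real.pi / 4) * (Real.pi * (δ - d))) := mul_le_mul_of_nonneg_left key h0
      _ ≤ _ := by
        apply mul_le_mul (by linarith) _ (by positivity) (by norm_num)
        gcongr
  nlinarith

lemma abs_sB_le {d δ : ℝ} (h1 : |d| ≤ δ) (h2 : δ ≤ 1/4) (k : ℤ) : |sB d k| ≤ sB δ k := by
  rw [sB_abs d]
  have h0 := abs_nonneg d
  generalize |d| = d at *
  have hπ := Real.pi_pos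
  unfold sB
  have hk := int_half_sq k
  have c0 : 0 ≤ Real.cos (Real.pi * d) :=
    Real.cos_nonneg_of_neg_pi_div_two_le_of_le (by nlinarith) (by nlinarith)
  have s1 := xcos_mono h0 h1 h2
  rw [abs_of_nonneg (div_nonneg (by positivity) (mul_nonneg hπ.le (by nlinarith)))]
  apply div_le_div₀
  · exact le_trans (by positivity) s1
  · exact s1
  · apply mul_pos hπ; nlinarith
  · apply mul_le_mul_of_nonneg_left _ hπ.le; nlinarith

lemma norm_int_sum (s : Finset ℤ) (c : ℤ → ℂ) :
    ‖∑ n ∈ s, c n • EL (n : ℝ)‖ = Real.sqrt (∑ n ∈ s, ‖c n‖ ^ 2) := by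
  have h := (orthonormal_fourier (T := (1:ℝ))).inner_sum c c s
  rw [inner_self_eq_norm_sq_to_K] at h
  simp_rw [EL_int]
  rw [eq_comm, Real.sqrt_eq_iff_mul_self_eq (Finset.sum_nonneg fun _ _ => by positivity)
    (norm_nonneg _), ← sq]
  apply Complex.ofReal_injective
  rw [Complex.ofReal_pow]
  refine Eq.trans ?_ h.symm
  rw [Complex.ofReal_sum]
  refine Finset.sum_congr rfl fun i _ => ?_
  rw [mul_comm, Complex.mul_conj, Complex.normSq_eq_norm_sq]

lemma aes (s : Finset ℤ) (c : ℤ → ℂ) :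
    AEStronglyMeasurable (fun x : Cr => ∑ n ∈ s, c n * fourier n x) hm := by
  apply Continuous.aestronglyMeasurable; fun_prop

lemma multiplier (s : Finset ℤ) (c : ℤ → ℂ) (B : ℤ → ℤ → ℂ) (M : ℤ → ℝ) (L : ℝ)
    (hB : ∀ n k, ‖B n k‖ ≤ M k) (hM : HasSum M L) (g : ℤ → Cr → ℂ)
    (hg : ∀ n x, HasSum (fun k => B n k * fourier k x) (g n x)) :
    eLpNorm (fun x => ∑ n ∈ s, c n * fourier n x * g n x) 2 hm ≤
      ENNReal.ofReal (L * Real.sqrt (∑ n ∈ s, ‖c n‖ ^ 2)) := by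
  have hM0 : ∀ k, 0 ≤ M k := fun k => (norm_nonneg _).trans (hB 0 k)
  obtain ⟨u, hu⟩ := exists_seq_tendsto (atTop : Filter (Finset ℤ))
  set F : Finset ℤ → Cr → ℂ := fun t => ∑ k ∈ t, fun x => fourier k x * ∑ n ∈ s, (c n * B n k) * fourier n x
    with hF
  have hFm : ∀ k : ℤ, AEStronglyMeasurable
      (fun x : Cr => fourier k x * ∑ n ∈ s, (c n * B n k) * fourier n x) hm := by
    intro k
    exact ((fourier k).continuous.aestronglyMeasurable).mul (aes s _)
  have h1 := Lp.eLpNorm_lim_le_liminf_eLpNorm (p := 2) (μ := hm) (f := fun N => F (u N))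
    (fun N => Finset.aestronglyMeasurable_sum _ fun k _ => hFm k)
    (fun x => ∑ n ∈ s, c n * fourier n x * g n x) (Eventually.of_forall fun x => by
      have : HasSum (fun k => ∑ n ∈ s, c n * fourier n x * (B n k * fourier k x))
          (∑ n ∈ s, c n * fourier n x * g n x) := hasSum_sum fun n _ => (hg n x).mul_left _
      refine (Tendsto.comp this hu).congr fun N => ?_
      simp only [hF, Function.comp, Finset.sum_apply]
      refine Finset.sum_congr rfl fun k _ => ?_
      rw [Finset.mul_sum]
      refine Finset.sum_congr rfl fun n _ => ?_
      ring)
  refine h1.trans ?_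
  refine liminf_le_of_frequently_le' (Frequently.of_forall fun N => ?_)
  have h2 : eLpNorm (F (u N)) 2 hm ≤ ∑ k ∈ u N, ENNReal.ofReal (M k * Real.sqrt (∑ n ∈ s, ‖c n‖ ^ 2)) := by
    refine (eLpNorm_sum_le (fun k _ => hFm k) (by norm_num)).trans ?_
    refine Finset.sum_le_sum fun k _ => ?_
    have : eLpNorm (fun x : Cr => fourier k x * ∑ n ∈ s, (c n * B n k) * fourier n x) 2 hm =
        eLpNorm (fun x : Cr => ∑ n ∈ s, (c n * B n k) * E (n : ℝ) x) 2 hm := by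
      apply eLpNorm_congr_norm_ae
      refine Eventually.of_forall fun x => ?_
      simp_rw [norm_mul, ← E_int, norm_E, one_mul]
    rw [this, ← norm_sum_EL s (fun n => c n * B n k) (fun n => (n : ℝ)), norm_int_sum]
    apply ENNReal.ofReal_le_ofReal
    rw [← Real.sqrt_sq (hM0 k), ← Real.sqrt_mul (sq_nonneg _)]
    apply Real.sqrt_le_sqrt
    rw [Finset.mul_sum]
    refine Finset.sum_le_sum fun n _ => ?_
    rw [norm_mul, mul_pow, mul_comm]
    have := hB n k
    gcongr
  refine h2.trans ?_
  rw [← ENNReal.ofReal_sum_of_nonneg (fun k _ => mul_nonneg (hM0 k) (Real.sqrt_nonneg _)),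
    ← Finset.sum_mul]
  apply ENNReal.ofReal_le_ofReal
  apply mul_le_mul_of_nonneg_right _ (Real.sqrt_nonneg _)
  exact sum_le_hasSum _ (fun k _ => hM0 k) hM

/-- the Kadec constant -/
def lam (δ : ℝ) : ℝ := (1 - Real.cos (Real.pi * δ)) + Real.sin (Real.pi * δ)

lemma lam_lt {δ : ℝ} (h0 : 0 ≤ δ) (h : δ < 1/4) : lam δ < 1 := by
  have hπ := Real.pi_pos
  have h1 : Real.sin (Real.pi * δ) < Real.sin (Real.pi / 4) :=
    Real.sin_lt_sin_of_lt_of_le_pi_div_two (by nlinarith) (by linarith) (by nlinarith)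
  have h2 : Real.cos (Real.pi / 4) < Real.cos (Real.pi * δ) :=
    Real.cos_lt_cos_of_nonneg_of_le_pi (by positivity) (by linarith) (by nlinarith)
  rw [Real.sin_pi_div_four] at h1
  rw [Real.cos_pi_div_four] at h2
  unfold lam; linarith

lemma lam_nonneg {δ : ℝ} (h0 : 0 ≤ δ) (h : δ < 1/4) : 0 ≤ lam δ := by
  have hπ := Real.pi_pos
  have h1 : 0 ≤ Real.sin (Real.pi * δ) :=
    Real.sin_nonneg_of_nonneg_of_le_pi (by positivity) (by nlinarith)
  have := Real.cos_le_one (Real.pi * δ)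
  unfold lam; linarith

lemma one_sub_E (d : ℝ) (x : Cr) : 1 - E d x =
    (1 - (Real.cos (2 * Real.pi * d * rep x) : ℂ)) +
      (-Complex.I) * (Real.sin (2 * Real.pi * d * rep x) : ℂ) := by
  rw [cos_eq, sin_eq]; unfold E
  linear_combination (-(ex d (rep x) - ex (-d) (rep x)) / 2) * Complex.I_sq

theorem kadec (y : ℤ → ℝ) (δ : ℝ) (hδ : δ < 1/4) (hy : ∀ n : ℤ, |y n - n| ≤ δ)
    (s : Finset ℤ) (c : ℤ → ℂ) :
    ‖∑ n ∈ s, c n • EL (n : ℝ) - ∑ n ∈ s, c n • EL (y n)‖ ≤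
      lam δ * ‖∑ n ∈ s, c n • EL (n : ℝ)‖ := by
  have h0 : 0 ≤ δ := (abs_nonneg _).trans (hy 0)
  have hπ := Real.pi_pos
  have hδ4 : |δ| ≤ 1/4 := by rw [abs_of_nonneg h0]; exact hδ.le
  have hd : ∀ n, |y n - n| ≤ 1/4 := fun n => (hy n).trans hδ.le
  rw [norm_int_sum]
  set R := Real.sqrt (∑ n ∈ s, ‖c n‖ ^ 2)
  have hR : 0 ≤ R := Real.sqrt_nonneg _
  have m1 := multiplier s c (fun n k => (((-1) ^ k * cA (y n - n) k : ℝ) : ℂ)) (cA δ) _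
    (fun n k => by simpa using abs_cA_le (hy n) hδ.le k) (hasSum_cA hδ4) _
    (fun n x => hasSum_cos (hd n) x)
  have m2 := multiplier s c (fun n k => Complex.I * (((-1) ^ k * sB (y n - n) k : ℝ) : ℂ)) (sB δ) _
    (fun n k => by simpa using abs_sB_le (hy n) hδ.le k) (hasSum_sB hδ4) _
    (fun n x => hasSum_sin (hd n) x)
  rw [← ENNReal.ofReal_le_ofReal_iff (mul_nonneg (lam_nonneg h0 hδ) hR), Lp.norm_def,
    ENNReal.ofReal_toReal (Lp.eLpNorm_ne_top _)]
  set f1 : Cr → ℂ := fun x => ∑ n ∈ s, c n * fourier n x * (1 - (Real.cos (2 * Real.pi * (y n - n) * rep x) : ℂ)) with hf1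
  set f2 : Cr → ℂ := fun x => ∑ n ∈ s, c n * fourier n x * ((-Complex.I) * (Real.sin (2 * Real.pi * (y n - n) * rep x) : ℂ)) with hf2
  have mr := measurable_rep
  have mm1 : AEStronglyMeasurable f1 hm := by
    apply Measurable.aestronglyMeasurable
    refine Finset.measurable_fun_sum _ fun n _ => ?_
    have := (fourier (T := (1:ℝ)) n).continuous.measurable
    fun_prop
  have mm2 : AEStronglyMeasurable f2 hm := by
    apply Measurable.aestronglyMeasurable
    refine Finset.measurable_fun_sum _ fun n _ => ?_
    have := (fourier (T := (1:ℝ)) n).continuous.measurable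
    fun_prop
  have e : ((∑ n ∈ s, c n • EL (n : ℝ) - ∑ n ∈ s, c n • EL (y n) : Lp ℂ 2 hm) : Cr → ℂ)
      =ᵐ[hm] f1 + f2 := by
    filter_upwards [Lp.coeFn_sub (∑ n ∈ s, c n • EL (n : ℝ)) (∑ n ∈ s, c n • EL (y n)),
      coeFn_sum s c (fun n => (n : ℝ)), coeFn_sum s c y] with x h1 h2 h3
    rw [h1, Pi.sub_apply, h2, h3, Pi.add_apply, hf1, hf2]
    simp only
    rw [← Finset.sum_sub_distrib, ← Finset.sum_add_distrib]
    refine Finset.sum_congr rfl fun n _ => ?_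
    rw [← mul_add, ← one_sub_E, ← E_int]
    have : E (y n) x = E n x * E (y n - n) x := by rw [← E_add]; congr 1; ring
    rw [this]; ring
  rw [eLpNorm_congr_ae e]
  refine (eLpNorm_add_le mm1 mm2 (by norm_num)).trans ?_
  have e2 : eLpNorm f2 2 hm = eLpNorm (fun x => ∑ n ∈ s, c n * fourier n x *
      ((Real.sin (2 * Real.pi * (y n - n) * rep x) : ℂ) * E (1/2) x)) 2 hm := by
    apply eLpNorm_congr_norm_ae
    refine Eventually.of_forall fun x => ?_
    have : ∑ n ∈ s, c n * fourier n x *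
      ((Real.sin (2 * Real.pi * (y n - n) * rep x) : ℂ) * E (1/2) x) = (Complex.I * E (1/2) x) * f2 x := by
      rw [hf2, Finset.mul_sum]
      refine Finset.sum_congr rfl fun n _ => ?_
      linear_combination (c n * fourier n x *
      ((Real.sin (2 * Real.pi * (y n - n) * rep x) : ℂ) * E (1/2) x)) * Complex.I_sq
    rw [this, norm_mul, norm_mul, norm_E, Complex.norm_I]; simp
  rw [e2]
  refine (add_le_add m1 m2).trans ?_
  rw [← ENNReal.ofReal_add]
  · apply ENNReal.ofReal_le_ofReal
    unfold lam; rw [add_mul]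
  · have := Real.cos_le_one (Real.pi * δ)
    apply mul_nonneg _ hR; linarith
  · apply mul_nonneg _ hR
    exact Real.sin_nonneg_of_nonneg_of_le_pi (by positivity) (by nlinarith)

lemma dense_int : (Submodule.span ℂ (Set.range fun n : ℤ => EL (n : ℝ))).topologicalClosure = ⊤ := by
  have h := span_fourierLp_closure_eq_top (T := (1 : ℝ)) (p := 2) (by norm_num)
  have e : (fun n : ℤ => EL (n : ℝ)) = fourierLp (T := (1 : ℝ)) 2 := funext EL_int
  rw [e]; exact h

lemma approx {z : ℤ → ℝ}
    (hz : (Submodule.span ℂ (Set.range fun n : ℤ => EL (z n))).topologicalClosure = ⊤)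
    (g : Lp ℂ 2 hm) {ε : ℝ} (hε : 0 < ε) :
    ∃ (s : Finset ℤ) (c : ℤ → ℂ), ‖g - ∑ n ∈ s, c n • EL (z n)‖ < ε := by
  have hg : g ∈ (Submodule.span ℂ (Set.range fun n : ℤ => EL (z n))).topologicalClosure := by
    rw [hz]; trivial
  rw [← SetLike.mem_coe, Submodule.topologicalClosure_coe, Metric.mem_closure_iff] at hg
  obtain ⟨b, hb, hd⟩ := hg ε hε
  rw [SetLike.mem_coe, Finsupp.mem_span_range_iff_exists_finsupp] at hb
  obtain ⟨c, rfl⟩ := hb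
  exact ⟨c.support, c, by rwa [dist_eq_norm] at hd⟩

lemma dense_y (y : ℤ → ℝ) (δ : ℝ) (hδ : δ < 1/4) (hy : ∀ n : ℤ, |y n - n| ≤ δ) :
    (Submodule.span ℂ (Set.range fun n : ℤ => EL (y n))).topologicalClosure = ⊤ := by
  have h0 : 0 ≤ δ := (abs_nonneg _).trans (hy 0)
  have hl := lam_lt h0 hδ
  have hl0 := lam_nonneg h0 hδ
  rw [Submodule.topologicalClosure_eq_top_iff, Submodule.eq_bot_iff]
  intro g hg
  by_contra hne
  have hpos : 0 < ‖g‖ := norm_pos_iff.mpr hne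
  set ε := (1 - lam δ) * ‖g‖ / 4 with hε
  have hε0 : 0 < ε := by have : 0 < 1 - lam δ := by linarith
                         positivity
  obtain ⟨s, c, hc⟩ := approx dense_int g hε0
  set p := ∑ n ∈ s, c n • EL (n : ℝ) with hp
  set q := ∑ n ∈ s, c n • EL (y n) with hq
  have hk : ‖p - q‖ ≤ lam δ * ‖p‖ := kadec y δ hδ hy s c
  have hqm : q ∈ Submodule.span ℂ (Set.range fun n : ℤ => EL (y n)) :=
    Submodule.sum_mem _ fun n _ => Submodule.smul_mem _ _ (Submodule.subset_span ⟨n, rfl⟩)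
  have hin : inner ℂ g q = 0 := Submodule.inner_left_of_mem_orthogonal hqm hg
  have hge : ‖g‖ ≤ ‖g - q‖ := by
    have h1 := norm_sub_sq (𝕜 := ℂ) g q
    rw [hin] at h1
    simp only [map_zero, mul_zero, sub_zero] at h1
    refine le_of_sq_le_sq ?_ (norm_nonneg _)
    nlinarith [sq_nonneg ‖q‖]
  have h2 : ‖g - q‖ ≤ ‖g - p‖ + ‖p - q‖ := by
    rw [← sub_add_sub_cancel g p q]; exact norm_add_le _ _
  have h3 : ‖p‖ ≤ ‖g‖ + ‖g - p‖ := by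
    have := norm_sub_norm_le p g
    rw [norm_sub_rev] at this; linarith
  nlinarith

lemma eLp_sq (f : ℝ → ℂ) : eLpNorm f 2 volume ^ 2 = ∫⁻ t, ‖f t‖ₑ ^ 2 := by
  rw [eLpNorm_eq_lintegral_rpow_enorm_toReal (by norm_num) (by norm_num)]
  simp only [ENNReal.toReal_ofNat, ENNReal.rpow_ofNat]
  rw [← ENNReal.rpow_natCast, ← ENNReal.rpow_mul]; norm_num

/-- a crude triangle inequality where only the second function has to be measurable -/
lemma crude (f g : ℝ → ℂ) (hg : Measurable g) {ε : ℝ} (hε : 0 < ε)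
    (h1 : eLpNorm f 2 volume < ENNReal.ofReal (ε / 2))
    (h2 : eLpNorm g 2 volume < ENNReal.ofReal (ε / 2)) :
    eLpNorm (fun t => f t + g t) 2 volume < ENNReal.ofReal ε := by
  have hs : eLpNorm (fun t => f t + g t) 2 volume ^ 2 < ENNReal.ofReal ε ^ 2 := by
    rw [eLp_sq]
    have : ∫⁻ t, ‖f t + g t‖ₑ ^ 2 ≤ ∫⁻ t, (2 * ‖f t‖ₑ ^ 2 + 2 * ‖g t‖ₑ ^ 2) := by
      refine lintegral_mono fun t => ?_
      simp only [← ofReal_norm]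
      rw [← ENNReal.ofReal_pow (norm_nonneg _), ← ENNReal.ofReal_pow (norm_nonneg _),
        ← ENNReal.ofReal_pow (norm_nonneg _), show (2 : ENNReal) = ENNReal.ofReal 2 by simp,
        ← ENNReal.ofReal_mul (by norm_num), ← ENNReal.ofReal_mul (by norm_num),
        ← ENNReal.ofReal_add (by positivity) (by positivity)]
      apply ENNReal.ofReal_le_ofReal
      have := norm_add_le (f t) (g t)
      nlinarith [sq_nonneg (‖f t‖ - ‖g t‖), norm_nonneg (f t + g t)]
    refine this.trans_lt ?_
    rw [lintegral_add_right _ ((hg.enorm.pow_const 2).const_mul 2),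
      lintegral_const_mul' _ _ (by norm_num), lintegral_const_mul' _ _ (by norm_num),
      ← eLp_sq, ← eLp_sq]
    have a1 := ENNReal.pow_lt_pow_left (n := 2) (two_ne_zero) h1
    have a2 := ENNReal.pow_lt_pow_left (n := 2) (two_ne_zero) h2
    have e : ENNReal.ofReal ε ^ 2 = 2 * ENNReal.ofReal (ε/2) ^ 2 + 2 * ENNReal.ofReal (ε/2) ^ 2 := by
      rw [← ENNReal.ofReal_pow hε.le, ← ENNReal.ofReal_pow (by positivity),
        show (2 : ENNReal) = ENNReal.ofReal 2 by simp, ← ENNReal.ofReal_mul (by norm_num),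
        ← ENNReal.ofReal_add (by positivity) (by positivity)]
      congr 1; ring
    rw [e]
    apply ENNReal.add_lt_add
    · exact (ENNReal.mul_lt_mul_iff_right (by norm_num) (by norm_num)).mpr a1
    · exact (ENNReal.mul_lt_mul_iff_right (by norm_num) (by norm_num)).mpr a2
  by_contra hcon
  exact absurd hs (not_lt.mpr (pow_le_pow_left' (not_lt.mp hcon) 2))

lemma measurable_comb (s : Finset ℤ) (c : ℤ → ℂ) (a : ℤ → ℝ) :
    Measurable (fun t => ∑ i ∈ s, c i * ((sinc (t - a i) : ℝ) : ℂ)) := by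
  refine Finset.measurable_fun_sum _ fun i _ => ?_
  exact (Complex.measurable_ofReal.comp
    (measurable_sinc.comp (measurable_id.sub_const _))).const_mul _

lemma transfer (y z : ℤ → ℝ)
    (hz : (Submodule.span ℂ (Set.range fun n : ℤ => EL (z n))).topologicalClosure = ⊤)
    (f : ℝ → ℂ) (hf : InV2 (fun t => ((sinc t : ℝ) : ℂ)) y f) :
    InV2 (fun t => ((sinc t : ℝ) : ℂ)) z f := by
  intro ε hε
  obtain ⟨s, c, h1⟩ := hf (ε/2) (by positivity)
  obtain ⟨s', c', h2⟩ := approx hz (∑ n ∈ s, c n • EL (y n)) (ε := ε/2) (by positivity)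
  refine ⟨s', c', ?_⟩
  have h3 := plancherel (s.disjSum s') (Sum.elim c (fun n => - c' n)) (Sum.elim y z)
  simp only [Finset.sum_disjSum, Sum.elim_inl, Sum.elim_inr, neg_smul, neg_mul,
    Finset.sum_neg_distrib, ← sub_eq_add_neg] at h3
  have h4 := crude _ _ ((measurable_comb s c y).sub (measurable_comb s' c' z)) hε h1
    (by
      refine lt_of_eq_of_lt h3 ?_
      rwa [ENNReal.ofReal_lt_ofReal_iff (by positivity)])
  refine lt_of_eq_of_lt ?_ h4
  congr 1
  ext t
  simp only [smul_eq_mul, Pi.sub_apply]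
  ring

end Kadec

/-- example in Section 3 of the paper. If `sup_n |y_n − n| ≤ δ < 1/4`,
then `{sinc(· − y_n)}_{n∈ℤ}` is a Riesz basis of `V²(sinc)`, and `V²(sinc; Y) = V²(sinc)`. -/
theorem stmt18 (y : ℤ → ℝ) (δ : ℝ) (hδ : δ < 1/4) (hy : ∀ n : ℤ, |y n - n| ≤ δ) :
    (∃ A B : ℝ, 0 < A ∧ 0 < B ∧ ∀ (s : Finset ℤ) (c : ℤ → ℂ),
      ENNReal.ofReal (A * (∑ n ∈ s, ‖c n‖ ^ 2) ^ (1/2 : ℝ)) ≤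
        eLpNorm (fun t => ∑ n ∈ s, c n • ((sinc (t - y n) : ℝ) : ℂ)) 2 volume ∧
      eLpNorm (fun t => ∑ n ∈ s, c n • ((sinc (t - y n) : ℝ) : ℂ)) 2 volume ≤
        ENNReal.ofReal (B * (∑ n ∈ s, ‖c n‖ ^ 2) ^ (1/2 : ℝ))) ∧
    (∀ f : ℝ → ℂ,
      InV2 (fun t => ((sinc t : ℝ) : ℂ)) y f ↔
      InV2 (fun t => ((sinc t : ℝ) : ℂ)) (fun n => (n : ℝ)) f) := by
  have h0 : 0 ≤ δ := (abs_nonneg _).trans (hy 0)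
  have hl := Kadec.lam_lt h0 hδ
  have hl0 := Kadec.lam_nonneg h0 hδ
  refine ⟨⟨1 - Kadec.lam δ, 1 + Kadec.lam δ, by linarith, by linarith, fun s c => ?_⟩, fun f => ⟨?_, ?_⟩⟩
  · simp only [smul_eq_mul]
    rw [Kadec.plancherel s c y, ← Real.sqrt_eq_rpow, ← Kadec.norm_int_sum]
    have hk := Kadec.kadec y δ hδ hy s c
    constructor
    · apply ENNReal.ofReal_le_ofReal
      have := norm_sub_norm_le (∑ n ∈ s, c n • Kadec.EL (n : ℝ)) (∑ n ∈ s, c n • Kadec.EL (y n))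
      linarith
    · apply ENNReal.ofReal_le_ofReal
      have := norm_sub_norm_le (∑ n ∈ s, c n • Kadec.EL (y n)) (∑ n ∈ s, c n • Kadec.EL (n : ℝ))
      rw [norm_sub_rev] at this
      linarith
  · exact Kadec.transfer _ _ Kadec.dense_int f
  · exact Kadec.transfer _ _ (Kadec.dense_y y δ hδ hy) f
end
end
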